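/- arXiv:1109.3983 — 3 statements merged into one kernel-verified Lean document; each statement's English description precedes it below -/
import Mathlib

section
/- Let A : ℝⁿ → Matₙ(ℝ) be a smooth matrix-valued map such that A(x) is symmetric for every x ∈ ℝⁿ and ∂A_{ij}/∂x_k = ∂A_{kj}/∂x_i on ℝⁿ for all indices i, j, k (i.e. the (1,1)-super form Σ_{i,j} A_{ij} dx_i∧dξ_j is closed). Then A(x) is positive semidefinite for every x ∈ ℝⁿ if and only if there exists a smooth convex function f : ℝⁿ → ℝ with A_{ij}(x) = ∂²f/∂x_i∂x_j(x) for all i, j and all x. -/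
open scoped BigOperators

theorem aux_fderiv_apply {n : ℕ} (L : (Fin n → ℝ) →L[ℝ] ℝ) (v : Fin n → ℝ) :
    L v = ∑ j, v j * L (Pi.single j 1) := by
  conv_lhs => rw [pi_eq_sum_univ' v]
  simp only [map_sum, map_smul, smul_eq_mul]

theorem aux_poincare {n : ℕ} (g : Fin n → (Fin n → ℝ) → ℝ)
    (hg : ∀ i, ContDiff ℝ (⊤ : ℕ∞) (g i))
    (hc : ∀ i k x, fderiv ℝ (g i) x (Pi.single k 1) = fderiv ℝ (g k) x (Pi.single i 1)) :
    ∃ f : (Fin n → ℝ) → ℝ, ContDiff ℝ (⊤ : ℕ∞) f ∧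
      ∀ x i, fderiv ℝ f x (Pi.single i 1) = g i x := by
  let ω : (Fin n → ℝ) → ((Fin n → ℝ) →L[ℝ] ℝ) :=
    fun x => ∑ i, g i x • (ContinuousLinearMap.proj i : (Fin n → ℝ) →L[ℝ] ℝ)
  have hω : ContDiff ℝ (⊤ : ℕ∞) ω :=
    ContDiff.sum fun i _ => (hg i).smul contDiff_const
  have hgd : ∀ i, Differentiable ℝ (g i) := fun i => (hg i).differentiable (by simp)
  have hωd : Differentiable ℝ ω := hω.differentiable (by simp)
  have hd : ∀ a, HasFDerivAt ω (∑ i, (fderiv ℝ (g i) a).smulRight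
      (ContinuousLinearMap.proj i : (Fin n → ℝ) →L[ℝ] ℝ)) a := fun a =>
    HasFDerivAt.fun_sum fun i _ => ((hgd i a).hasFDerivAt).smul_const
      (ContinuousLinearMap.proj i : (Fin n → ℝ) →L[ℝ] ℝ)
  obtain ⟨f, hf⟩ := (convex_univ (𝕜 := ℝ) (E := Fin n → ℝ)).exists_forall_hasFDerivAt_of_fderiv_symmetric
    isOpen_univ hωd.differentiableOn (by
      intro a _ x y
      rw [(hd a).fderiv]
      simp only [sum_apply, ContinuousLinearMap.smulRight_apply,
        smul_apply, ContinuousLinearMap.proj_apply, smul_eq_mul]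
      have key : ∀ x y : Fin n → ℝ, ∑ i, fderiv ℝ (g i) a x * y i =
          ∑ i, ∑ j, x j * fderiv ℝ (g i) a (Pi.single j 1) * y i := fun x y =>
        Finset.sum_congr rfl fun i _ => by
          rw [aux_fderiv_apply (fderiv ℝ (g i) a) x, Finset.sum_mul]
      rw [key, key]
      rw [Finset.sum_comm]
      refine Finset.sum_congr rfl fun i _ => Finset.sum_congr rfl fun j _ => ?_
      rw [hc]; ring)
  have hff : fderiv ℝ f = ω := funext fun x => (hf x trivial).fderiv
  refine ⟨f, ?_, ?_⟩
  · rw [contDiff_infty_iff_fderiv, hff]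
    exact ⟨fun x => (hf x trivial).differentiableAt, hω⟩
  · intro x i
    rw [hff]
    simp [ω, Pi.single_apply]

theorem aux_line {n : ℕ} (f : (Fin n → ℝ) → ℝ) (hf : Differentiable ℝ f)
    (x v : Fin n → ℝ) (t : ℝ) :
    HasDerivAt (fun s : ℝ => f (x + s • v))
      (∑ j, v j * fderiv ℝ f (x + t • v) (Pi.single j 1)) t := by
  rw [← aux_fderiv_apply]
  have h1 : HasDerivAt (fun s : ℝ => x + s • v) v t := by
    simpa using ((hasDerivAt_id t).smul_const v).const_add x
  exact (hf _).hasFDerivAt.comp_hasDerivAt t h1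

theorem aux_line2 {n : ℕ} (A : (Fin n → ℝ) → Matrix (Fin n) (Fin n) ℝ)
    (f : (Fin n → ℝ) → ℝ) (hf : ContDiff ℝ (⊤ : ℕ∞) f)
    (hA : ∀ (x : Fin n → ℝ) (i j : Fin n),
      A x i j = fderiv ℝ (fun y => fderiv ℝ f y (Pi.single j 1)) x (Pi.single i 1))
    (x v : Fin n → ℝ) (t : ℝ) :
    HasDerivAt (fun s : ℝ => ∑ j, v j * fderiv ℝ f (x + s • v) (Pi.single j 1))
      (star v ⬝ᵥ (A (x + t • v)).mulVec v) t := by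
  have h : ∀ j : Fin n, Differentiable ℝ (fun y => fderiv ℝ f y (Pi.single j 1)) := fun j =>
    (((contDiff_infty_iff_fderiv.1 hf).2.clm_apply contDiff_const).differentiable (by simp))
  have := HasDerivAt.fun_sum (u := Finset.univ) fun (j : Fin n) _ =>
    (aux_line _ (h j) x v t).const_mul (v j)
  refine this.congr_deriv ?_
  simp only [← hA, dotProduct, Matrix.mulVec, Finset.mul_sum, star_trivial]
  rw [Finset.sum_comm]
  refine Finset.sum_congr rfl fun i _ => Finset.sum_congr rfl fun j _ => ?_
  ring

/-- let `A : ℝⁿ → Matₙ(ℝ)` be a smooth matrix-valued map with `A(x)`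
symmetric for every `x` and `∂A_{ij}/∂x_k = ∂A_{kj}/∂x_i` for all `i, j, k` (i.e. the
`(1,1)`-super form `Σ A_{ij} dx_i ∧ dξ_j` is closed). Then `A(x)` is positive
semidefinite for every `x` iff there is a smooth convex `f : ℝⁿ → ℝ` with
`A_{ij} = ∂²f/∂x_i∂x_j` everywhere. -/
theorem closed_positive_one_one_form_iff_hessian_of_convex
    (n : ℕ) (A : (Fin n → ℝ) → Matrix (Fin n) (Fin n) ℝ)
    (hsmooth : ∀ i j : Fin n, ContDiff ℝ (⊤ : ℕ∞) fun x => A x i j)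
    (hsymm : ∀ x, (A x).IsSymm)
    (hclosed : ∀ (i j k : Fin n) (x : Fin n → ℝ),
      fderiv ℝ (fun y => A y i j) x (Pi.single k 1)
        = fderiv ℝ (fun y => A y k j) x (Pi.single i 1)) :
    (∀ x, (A x).PosSemidef) ↔
      ∃ f : (Fin n → ℝ) → ℝ, ContDiff ℝ (⊤ : ℕ∞) f ∧ ConvexOn ℝ Set.univ f ∧
        ∀ (x : Fin n → ℝ) (i j : Fin n),
          A x i j = fderiv ℝ (fun y => fderiv ℝ f y (Pi.single j 1)) x (Pi.single i 1) := by
  constructor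
  · intro hpos
    have h1 : ∀ j, ∃ F : (Fin n → ℝ) → ℝ, ContDiff ℝ (⊤ : ℕ∞) F ∧
        ∀ x i, fderiv ℝ F x (Pi.single i 1) = A x i j := fun j =>
      aux_poincare (fun i x => A x i j) (fun i => hsmooth i j) (fun i k x => hclosed i j k x)
    choose F hF hFA using h1
    obtain ⟨f, hf, hfF⟩ := aux_poincare F hF (fun i k x => by
      rw [hFA, hFA]; exact (hsymm x).apply i k)
    have hA : ∀ (x : Fin n → ℝ) (i j : Fin n),
        A x i j = fderiv ℝ (fun y => fderiv ℝ f y (Pi.single j 1)) x (Pi.single i 1) := by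
      intro x i j
      simp_rw [hfF]
      exact (hFA j x i).symm
    refine ⟨f, hf, ⟨convex_univ, ?_⟩, hA⟩
    intro x _ y _ a b ha hb hab
    have hφ : ConvexOn ℝ Set.univ (fun s : ℝ => f (x + s • (y - x))) :=
      convexOn_of_hasDerivWithinAt2_nonneg convex_univ
        (fun t _ => (aux_line f (hf.differentiable (by simp)) x (y - x) t).continuousAt.continuousWithinAt)
        (fun t _ => (aux_line f (hf.differentiable (by simp)) x (y - x) t).hasDerivWithinAt)
        (fun t _ => (aux_line2 A f hf hA x (y - x) t).hasDerivWithinAt)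
        (fun t _ => (hpos _).dotProduct_mulVec_nonneg _)
    have := hφ.2 (Set.mem_univ 0) (Set.mem_univ 1) ha hb hab
    have e : a • x + b • y = x + b • (y - x) := by
      rw [← eq_sub_iff_add_eq] at hab
      subst hab
      module
    rw [e]
    simpa using this
  · rintro ⟨f, hf, hconv, hA⟩ x
    refine Matrix.PosSemidef.of_dotProduct_mulVec_nonneg ?_ fun v => ?_
    · rw [Matrix.IsHermitian, Matrix.conjTranspose_eq_transpose_of_trivial]
      exact hsymm x
    have hd := aux_line f (hf.differentiable (by simp)) x v
    have hφ : ConvexOn ℝ Set.univ (fun s : ℝ => f (x + s • v)) := by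
      refine ⟨convex_univ, fun s _ t _ a b ha hb hab => ?_⟩
      have e : x + (a • s + b • t) • v = a • (x + s • v) + b • (x + t • v) := by
        rw [← eq_sub_iff_add_eq] at hab
        subst hab
        module
      simp only [e]
      exact hconv.2 trivial trivial ha hb hab
    have hm := hφ.monotoneOn_deriv (fun t _ => (hd t).differentiableAt)
    have e : deriv (fun s : ℝ => f (x + s • v)) =
        fun s => ∑ j, v j * fderiv ℝ f (x + s • v) (Pi.single j 1) :=
      funext fun t => (hd t).deriv
    rw [e, monotoneOn_univ] at hm
    have h2 := aux_line2 A f hf hA x v 0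
    have := hm.deriv_nonneg (x := 0)
    rw [h2.deriv] at this
    simpa using this
end

section
/- For every smooth super form α on ℝⁿ (with respect to the flat ℝ-Kähler metric ω = Σ dx_i∧dξ_i), Λ(dα) − d(Λα) = (−1)ⁿ * d * (α). -/
open scoped BigOperators

noncomputable section

/-- The exterior algebra `⋀(ℝ^{2n})`, represented concretely: an element is given by its
coordinates in the basis of wedge monomials indexed by subsets of `Fin (2*n)`
(the first `n` basis indices correspond to `dx_1, …, dx_n`, the last `n` to `dξ_1, …, dξ_n`). -/
abbrev SForm (n : ℕ) := Finset (Fin (2 * n)) → ℝ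

/-- The inner product making the wedge monomials an orthonormal basis. -/
def sip {n : ℕ} (x y : SForm n) : ℝ := ∑ s : Finset (Fin (2 * n)), x s * y s

/-- The wedge product, written in coordinates over the monomial basis; the sign
counts the inversions between the two index sets. -/
def wedge {n : ℕ} (x y : SForm n) : SForm n := fun s =>
  ∑ a ∈ s.powerset,
    (-1 : ℝ) ^ (((a ×ˢ (s \ a)).filter fun q => q.2 < q.1).card) * x a * y (s \ a)

/-- `x` is a `k`-form: it is supported on monomials of degree `k`. -/
def IsForm {n : ℕ} (k : ℕ) (x : SForm n) : Prop := ∀ s, x s ≠ 0 → s.card = k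

/-- Index of `dx_i` among the `2n` basis vectors. -/
def dxI (n : ℕ) (i : Fin n) : Fin (2 * n) := ⟨i.1, by have := i.2; omega⟩

/-- Index of `dξ_i` among the `2n` basis vectors. -/
def dxiI (n : ℕ) (i : Fin n) : Fin (2 * n) := ⟨n + i.1, by have := i.2; omega⟩

/-- The basic one-form `dx_i`. -/
def sDx (n : ℕ) (i : Fin n) : SForm n := fun s => if s = {dxI n i} then 1 else 0

/-- The basic one-form `dξ_i`. -/
def sDxi (n : ℕ) (i : Fin n) : SForm n := fun s => if s = {dxiI n i} then 1 else 0

/-- The unit `1` of the exterior algebra. -/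
def sOne (n : ℕ) : SForm n := fun s => if s = ∅ then 1 else 0

/-- The standard Kähler form `ω = Σ_i dx_i ∧ dξ_i`. -/
def omegaF (n : ℕ) : SForm n := ∑ i : Fin n, wedge (sDx n i) (sDxi n i)

/-- The Lefschetz operator `L = ω ∧ ·`. -/
def Lop (n : ℕ) (x : SForm n) : SForm n := wedge (omegaF n) x

/-- The iterate `L^m`. -/
def Lpow (n : ℕ) (m : ℕ) (x : SForm n) : SForm n := (Lop n)^[m] x

/-- The power `ω^m`. -/
def omegaPow (n : ℕ) (m : ℕ) : SForm n := Lpow n m (sOne n)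

/-- `ω_n = ω^n / n!`, the volume form. -/
def omegaTop (n : ℕ) : SForm n := ((n.factorial : ℝ))⁻¹ • omegaPow n n

/-- The super-differential `dα = Σ_i dx_i ∧ ∂α/∂x_i` of a super form
`α : ℝⁿ → ⋀(ℝ^{2n})`. -/
def dS (n : ℕ) (α : (Fin n → ℝ) → SForm n) : (Fin n → ℝ) → SForm n :=
  fun x => ∑ i : Fin n, wedge (sDx n i) (fderiv ℝ α x (Pi.single i 1))

/-- The super-differential `d#α = Σ_i dξ_i ∧ ∂α/∂x_i` of a super form. -/
def dSh (n : ℕ) (α : (Fin n → ℝ) → SForm n) : (Fin n → ℝ) → SForm n :=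
  fun x => ∑ i : Fin n, wedge (sDxi n i) (fderiv ℝ α x (Pi.single i 1))

namespace SAux

/-- sign of moving the index `a` into the set `s`. -/
def sg {m : ℕ} (a : Fin m) (s : Finset (Fin m)) : ℝ := (-1 : ℝ) ^ (s.filter (· < a)).card

lemma sg_sq {m : ℕ} (a : Fin m) (s : Finset (Fin m)) : sg a s * sg a s = 1 := by
  unfold sg; rw [← pow_add, ← two_mul, pow_mul]; simp

lemma sg_erase_self {m : ℕ} (a : Fin m) (s : Finset (Fin m)) : sg a (s.erase a) = sg a s := by
  unfold sg
  congr 2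
  ext b; simp only [Finset.mem_filter, Finset.mem_erase]
  constructor
  · rintro ⟨⟨_, h⟩, h2⟩; exact ⟨h, h2⟩
  · rintro ⟨h, h2⟩; exact ⟨⟨ne_of_lt h2, h⟩, h2⟩

lemma sg_insert_self {m : ℕ} (a : Fin m) (s : Finset (Fin m)) : sg a (insert a s) = sg a s := by
  rw [← sg_erase_self a (insert a s), ← sg_erase_self a s, Finset.erase_insert_eq_erase]

lemma sg_insert {m : ℕ} {a b : Fin m} {s : Finset (Fin m)} (h : b ∉ s) :
    sg a (insert b s) = (if b < a then -1 else 1) * sg a s := by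
  unfold sg
  rw [Finset.filter_insert]
  split_ifs with hb
  · rw [Finset.card_insert_of_notMem (by simp [h]), pow_succ]; ring
  · simp

lemma sg_erase {m : ℕ} {a b : Fin m} {s : Finset (Fin m)} (h : b ∈ s) :
    sg a (s.erase b) = (if b < a then -1 else 1) * sg a s := by
  have := sg_insert (a := a) (Finset.notMem_erase b s)
  rw [Finset.insert_erase h] at this
  rw [this]; split_ifs <;> ring

variable {n : ℕ}

/-- exterior multiplication by the basis one-form `a`. -/
def E (a : Fin (2 * n)) : SForm n →ₗ[ℝ] SForm n where
  toFun y := fun s => if a ∈ s then sg a s * y (s.erase a) else 0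
  map_add' x y := by ext s; simp only [Pi.add_apply]; split_ifs <;> ring
  map_smul' c y := by
    ext s; simp only [Pi.smul_apply, smul_eq_mul, RingHom.id_apply]; split_ifs <;> ring

/-- interior multiplication by the basis one-form `a`. -/
def I (a : Fin (2 * n)) : SForm n →ₗ[ℝ] SForm n where
  toFun y := fun s => if a ∈ s then 0 else sg a s * y (insert a s)
  map_add' x y := by ext s; simp only [Pi.add_apply]; split_ifs <;> ring
  map_smul' c y := by
    ext s; simp only [Pi.smul_apply, smul_eq_mul, RingHom.id_apply]; split_ifs <;> ring

/-- degree operator -/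
def N : SForm n →ₗ[ℝ] SForm n where
  toFun y := fun s => (s.card : ℝ) * y s
  map_add' x y := by ext s; simp only [Pi.add_apply]; ring
  map_smul' c y := by
    ext s; simp only [Pi.smul_apply, smul_eq_mul, RingHom.id_apply]; ring

/-- parity operator -/
def P : SForm n →ₗ[ℝ] SForm n where
  toFun y := fun s => (-1 : ℝ) ^ s.card * y s
  map_add' x y := by ext s; simp only [Pi.add_apply]; ring
  map_smul' c y := by
    ext s; simp only [Pi.smul_apply, smul_eq_mul, RingHom.id_apply]; ring

lemma E_apply (a : Fin (2 * n)) (y : SForm n) (s) :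
    E a y s = if a ∈ s then sg a s * y (s.erase a) else 0 := rfl
lemma I_apply (a : Fin (2 * n)) (y : SForm n) (s) :
    I a y s = if a ∈ s then 0 else sg a s * y (insert a s) := rfl
lemma N_apply (y : SForm n) (s) : N y s = (s.card : ℝ) * y s := rfl
lemma P_apply (y : SForm n) (s) : P y s = (-1 : ℝ) ^ s.card * y s := rfl

lemma EE (a b : Fin (2 * n)) (h : a ≠ b) (y : SForm n) : E a (E b y) = - E b (E a y) := by
  ext s
  simp only [E_apply, Pi.neg_apply, Finset.mem_erase]
  by_cases ha : a ∈ s <;> by_cases hb : b ∈ s <;> simp [ha, hb, h, h.symm]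
  rw [sg_erase ha, sg_erase hb, Finset.erase_right_comm]
  rcases lt_or_gt_of_ne h with h1 | h1 <;> simp [h1, h1.not_gt] <;> ring

lemma IE_self (a : Fin (2 * n)) (y : SForm n) : I a (E a y) = y - E a (I a y) := by
  ext s
  simp only [E_apply, I_apply, Pi.sub_apply]
  by_cases ha : a ∈ s
  · simp [ha]
    rw [sg_erase_self, ← mul_assoc, sg_sq]; simp
  · simp [ha]
    rw [sg_insert_self, ← mul_assoc, sg_sq]; simp

lemma IE_ne (a b : Fin (2 * n)) (h : a ≠ b) (y : SForm n) : I a (E b y) = - E b (I a y) := by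
  ext s
  simp only [E_apply, I_apply, Pi.neg_apply, Finset.mem_erase, Finset.mem_insert]
  by_cases ha : a ∈ s <;> by_cases hb : b ∈ s <;> simp [ha, hb, h, h.symm]
  rw [sg_erase hb, sg_insert ha, Finset.erase_insert_of_ne h]
  rcases lt_or_gt_of_ne h with h1 | h1 <;> simp [h1, h1.not_gt] <;> ring

lemma EI_apply (a : Fin (2 * n)) (y : SForm n) (s) : E a (I a y) s = if a ∈ s then y s else 0 := by
  simp only [E_apply, I_apply]
  by_cases ha : a ∈ s
  · simp [ha]
    rw [sg_erase_self, ← mul_assoc, sg_sq]; simp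
  · simp [ha]

lemma N_eq (y : SForm n) : N y = ∑ a, E a (I a y) := by
  ext s
  rw [Finset.sum_apply, N_apply]
  simp only [EI_apply]
  simp

lemma NE (a : Fin (2 * n)) (y : SForm n) : N (E a y) = E a y + E a (N y) := by
  ext s
  simp only [N_apply, E_apply, Pi.add_apply]
  split_ifs with h
  · rw [← Finset.card_erase_add_one h]; push_cast; ring
  · simp

lemma PE (a : Fin (2 * n)) (y : SForm n) : P (E a y) = - E a (P y) := by
  ext s
  simp only [P_apply, E_apply, Pi.neg_apply]
  split_ifs with h
  · rw [← Finset.card_erase_add_one h]; rw [pow_succ]; ring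
  · simp

lemma P_P (y : SForm n) : P (P y) = y := by
  ext s
  simp only [P_apply]
  rw [← mul_assoc, ← pow_add, ← two_mul, pow_mul]; simp

lemma I_one (a : Fin (2 * n)) : I a (sOne n) = 0 := by
  ext s; simp [I_apply, sOne]

lemma N_one : N (sOne n) = 0 := by
  ext s; simp only [N_apply, sOne]; split_ifs with h <;> simp [h]

lemma P_one : P (sOne n) = sOne n := by
  ext s; simp only [P_apply, sOne]; split_ifs with h <;> simp [h]

lemma isForm_iff (k : ℕ) (y : SForm n) : IsForm k y ↔ N y = (k : ℝ) • y := by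
  constructor
  · intro h; ext s
    simp only [N_apply, Pi.smul_apply, smul_eq_mul]
    by_cases hy : y s = 0
    · simp [hy]
    · rw [h s hy]
  · intro h s hs
    have := congrFun h s
    simp only [N_apply, Pi.smul_apply, smul_eq_mul] at this
    exact_mod_cast mul_right_cancel₀ hs this

lemma single_insert (a : Fin (2 * n)) (s : Finset (Fin (2 * n))) (h : a ∉ s) :
    (Pi.single (insert a s) 1 : SForm n) = sg a s • E a (Pi.single s 1) := by
  ext t
  simp only [Pi.smul_apply, E_apply, smul_eq_mul, Pi.single_apply]
  by_cases ht : t = insert a s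
  · subst ht
    simp [Finset.erase_insert h, sg_insert_self, sg_sq]
  · by_cases hat : a ∈ t
    · have : t.erase a ≠ s := by
        rintro rfl; exact ht (Finset.insert_erase hat).symm
      simp [ht, this]
    · simp [ht, hat]

lemma form_eq_sum (y : SForm n) : y = ∑ s, y s • (Pi.single s 1 : SForm n) := by
  ext t; simp [Finset.sum_apply, Pi.single_apply]

lemma gen (p : Submodule ℝ (SForm n)) (h1 : sOne n ∈ p)
    (hE : ∀ a y, y ∈ p → E a y ∈ p) (y : SForm n) : y ∈ p := by
  rw [form_eq_sum y]
  refine p.sum_mem fun s _ => p.smul_mem _ ?_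
  induction s using Finset.induction_on with
  | empty =>
    convert h1 using 1
    ext t; simp [sOne, Pi.single_apply]
  | insert a s ha ih =>
    rw [single_insert a s ha]
    exact p.smul_mem _ (hE _ _ (ih (Finset.mem_univ _)))

lemma gen_eq (T S : SForm n →ₗ[ℝ] SForm n) (h1 : T (sOne n) = S (sOne n))
    (hE : ∀ a y, T y = S y → T (E a y) = S (E a y)) (y : SForm n) : T y = S y :=
  gen (LinearMap.eqLocus T S) h1 hE y

lemma sip_single (s) (y : SForm n) : sip (Pi.single s 1) y = y s := by
  simp [sip, Pi.single_apply]

lemma sip_E (a : Fin (2 * n)) (x y : SForm n) : sip (E a x) y = sip x (I a y) := by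
  unfold sip
  simp only [E_apply, I_apply, ite_mul, zero_mul, mul_ite, mul_zero]
  rw [← Finset.sum_filter]
  have : ∀ s : Finset (Fin (2 * n)), (if a ∈ s then (0:ℝ) else x s * (sg a s * y (insert a s)))
    = if a ∉ s then x s * (sg a s * y (insert a s)) else 0 := by intro s; split_ifs <;> simp_all
  simp only [this]
  rw [← Finset.sum_filter]
  refine Finset.sum_bij' (fun s _ => s.erase a) (fun s _ => insert a s) ?_ ?_ ?_ ?_ ?_
  · intro s hs; simp
  · intro s hs; simp
  · intro s hs; simp at hs; exact Finset.insert_erase hs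
  · intro s hs; simp at hs; exact Finset.erase_insert hs
  · intro s hs; simp at hs
    rw [Finset.insert_erase hs, sg_erase_self]; ring

lemma wedge_single (a : Finset (Fin (2 * n))) (y : SForm n) (s) :
    wedge (Pi.single a 1) y s = if a ⊆ s then
      (-1 : ℝ) ^ (((a ×ˢ (s \ a)).filter fun q => q.2 < q.1).card) * y (s \ a) else 0 := by
  unfold wedge
  split_ifs with h
  · rw [Finset.sum_eq_single a]
    · simp
    · intro b _ hb; simp [Pi.single_apply, hb]
    · intro hh; simp [h] at hh
  · refine Finset.sum_eq_zero fun b hb => ?_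
    have : b ≠ a := by rintro rfl; simp at hb; exact h hb
    simp [Pi.single_apply, this]

lemma wedge_singleton (a : Fin (2 * n)) (y : SForm n) :
    wedge (Pi.single {a} 1) y = E a y := by
  ext s
  rw [wedge_single, E_apply]
  simp only [Finset.singleton_subset_iff]
  split_ifs with h
  · rw [← Finset.erase_eq, ← sg_erase_self]
    congr 2
    rw [Finset.singleton_product, Finset.filter_map, Finset.card_map]
    rfl
  · rfl

lemma wedge_dx (i : Fin n) (y : SForm n) : wedge (sDx n i) y = E (dxI n i) y := by
  rw [← wedge_singleton]; congr 1; ext s; simp [sDx, Pi.single_apply]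

lemma wedge_dxi (i : Fin n) (y : SForm n) : wedge (sDxi n i) y = E (dxiI n i) y := by
  rw [← wedge_singleton]; congr 1; ext s; simp [sDxi, Pi.single_apply]

lemma wedge_pair (a b : Fin (2 * n)) (h : a < b) (y : SForm n) :
    wedge (wedge (Pi.single {a} 1) (Pi.single {b} 1)) y = E a (E b y) := by
  have h1 : wedge (Pi.single {a} 1) (Pi.single {b} 1) = (Pi.single {a, b} 1 : SForm n) := by
    rw [wedge_singleton, single_insert a {b} (by simp [h.ne])]
    have : sg a {b} = 1 := by simp [sg, Finset.filter_singleton, h.not_gt]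
    rw [this, one_smul]
  rw [h1]
  ext s
  rw [wedge_single]
  simp only [E_apply, Finset.mem_erase, Finset.insert_subset_iff, Finset.singleton_subset_iff]
  by_cases ha : a ∈ s <;> by_cases hb : b ∈ s <;> simp [ha, hb, h.ne']
  have hs : s \ {a, b} = (s.erase a).erase b := by ext; simp; tauto
  rw [hs, ← mul_assoc]
  congr 1
  rw [← sg_erase_self b (s.erase a), ← sg_erase_self a s]
  have : sg a ((s.erase a).erase b) = sg a (s.erase a) := by
    rw [sg_erase (by simp [hb, h.ne'])]; simp [h.not_gt]
  rw [← this, sg, sg, ← pow_add]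
  congr 1
  generalize (s.erase a).erase b = t
  rw [Finset.insert_eq, Finset.union_product, Finset.filter_union, Finset.card_union_of_disjoint]
  · simp only [Finset.singleton_product, Finset.filter_map, Finset.card_map]; rfl
  · rw [Finset.disjoint_left]; simp; intros; omega

lemma wedge_add_left (x y z : SForm n) : wedge (x + y) z = wedge x z + wedge y z := by
  ext s; simp only [wedge, Pi.add_apply, ← Finset.sum_add_distrib]
  exact Finset.sum_congr rfl fun _ _ => by ring

lemma wedge_zero_left (z : SForm n) : wedge 0 z = 0 := by
  ext s; simp [wedge]

lemma wedge_sum_left {ι : Type*} (t : Finset ι) (f : ι → SForm n) (z : SForm n) :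
    wedge (∑ i ∈ t, f i) z = ∑ i ∈ t, wedge (f i) z := by
  classical
  induction t using Finset.induction_on with
  | empty => simp [wedge_zero_left]
  | insert a s ha ih => rw [Finset.sum_insert ha, Finset.sum_insert ha, wedge_add_left, ih]

lemma Lop_eq (y : SForm n) : Lop n y = ∑ i, E (dxI n i) (E (dxiI n i) y) := by
  unfold Lop omegaF
  rw [wedge_sum_left]
  refine Finset.sum_congr rfl fun i _ => ?_
  rw [← wedge_pair _ _ (by simp only [dxI, dxiI, Fin.lt_def]; omega)]
  congr 2
  · ext s; simp [sDx, Pi.single_apply]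
  · ext s; simp [sDxi, Pi.single_apply]

lemma dx_ne_dxi (i j : Fin n) : dxI n i ≠ dxiI n j := by
  simp [dxI, dxiI]; omega
lemma dx_inj {i j : Fin n} : dxI n i = dxI n j ↔ i = j := by
  simp [dxI, Fin.ext_iff]
lemma dxi_inj {i j : Fin n} : dxiI n i = dxiI n j ↔ i = j := by
  simp [dxiI, Fin.ext_iff]

lemma idx_cases (a : Fin (2 * n)) : (∃ i, a = dxI n i) ∨ ∃ i, a = dxiI n i := by
  by_cases h : a.1 < n
  · exact Or.inl ⟨⟨a.1, h⟩, by simp [dxI]⟩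
  · exact Or.inr ⟨⟨a.1 - n, by omega⟩, by simp [dxiI, Fin.ext_iff]; omega⟩

lemma sum_idx (f : Fin (2 * n) → SForm n) :
    ∑ a, f a = ∑ i, f (dxI n i) + ∑ i, f (dxiI n i) := by
  have h : n + n = 2 * n := by omega
  rw [← (finCongr h).sum_comp, Fin.sum_univ_add]
  rfl

/-- explicit Λ -/
def Lm : SForm n →ₗ[ℝ] SForm n := ∑ i, (I (dxiI n i)) ∘ₗ (I (dxI n i))

lemma Lm_apply (y : SForm n) : Lm y = ∑ i, I (dxiI n i) (I (dxI n i) y) := by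
  simp [Lm]

lemma sip_sum_left {ι : Type*} (t : Finset ι) (f : ι → SForm n) (z : SForm n) :
    sip (∑ i ∈ t, f i) z = ∑ i ∈ t, sip (f i) z := by
  simp only [sip, Finset.sum_apply, Finset.sum_mul]; rw [Finset.sum_comm]

lemma sip_comm (x y : SForm n) : sip x y = sip y x := by
  simp only [sip, mul_comm]

lemma sip_L (x y : SForm n) : sip (Lop n x) y = sip x (Lm y) := by
  rw [Lop_eq, Lm_apply, sip_sum_left, sip_comm x, sip_sum_left]
  refine Finset.sum_congr rfl fun i _ => ?_
  rw [sip_E, sip_E, sip_comm]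

lemma Lm_unique (Lam : SForm n →ₗ[ℝ] SForm n)
    (hLam : ∀ x y : SForm n, sip (Lop n x) y = sip x (Lam y)) (y : SForm n) : Lam y = Lm y := by
  ext s
  rw [← sip_single s (Lam y), ← sip_single s (Lm y), ← hLam, sip_L]

lemma Lm_dx (i : Fin n) (y : SForm n) :
    Lm (E (dxI n i) y) = E (dxI n i) (Lm y) + I (dxiI n i) y := by
  rw [Lm_apply, Lm_apply, map_sum]
  have : ∀ j, I (dxiI n j) (I (dxI n j) (E (dxI n i) y)) =
      E (dxI n i) (I (dxiI n j) (I (dxI n j) y)) + if j = i then I (dxiI n j) y else 0 := by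
    intro j
    split_ifs with h
    · subst h
      rw [IE_self, map_sub, IE_ne _ _ (dx_ne_dxi _ _).symm]; abel
    · rw [IE_ne _ _ (mt dx_inj.1 h), map_neg, IE_ne _ _ (dx_ne_dxi _ _).symm]; simp
  simp only [this, Finset.sum_add_distrib]
  simp

lemma Lm_dxi (i : Fin n) (y : SForm n) :
    Lm (E (dxiI n i) y) = E (dxiI n i) (Lm y) - I (dxI n i) y := by
  rw [Lm_apply, Lm_apply, map_sum]
  have : ∀ j, I (dxiI n j) (I (dxI n j) (E (dxiI n i) y)) =
      E (dxiI n i) (I (dxiI n j) (I (dxI n j) y)) - if j = i then I (dxI n j) y else 0 := by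
    intro j
    rw [IE_ne _ _ (dx_ne_dxi _ _), map_neg]
    split_ifs with h
    · subst h
      rw [IE_self]; abel
    · rw [IE_ne _ _ (mt dxi_inj.1 h)]; simp
  simp only [this, Finset.sum_sub_distrib]
  simp

lemma Lm_L (y : SForm n) : Lm (Lop n y) = Lop n (Lm y) + ((n : ℝ) • y - N y) := by
  rw [Lop_eq, Lop_eq, map_sum, N_eq, sum_idx]
  have : ∀ i, Lm (E (dxI n i) (E (dxiI n i) y)) = E (dxI n i) (E (dxiI n i) (Lm y)) +
     (y - (E (dxI n i) (I (dxI n i) y) + E (dxiI n i) (I (dxiI n i) y))) := by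
    intro i
    rw [Lm_dx, Lm_dxi, IE_self, map_sub]; abel
  simp only [this, Finset.sum_add_distrib, Finset.sum_sub_distrib]
  simp [← Nat.cast_smul_eq_nsmul ℝ]

lemma N_L (y : SForm n) : N (Lop n y) = Lop n (N y) + (2 : ℝ) • Lop n y := by
  rw [Lop_eq, Lop_eq, map_sum, Finset.smul_sum, ← Finset.sum_add_distrib]
  refine Finset.sum_congr rfl fun i _ => ?_
  rw [NE, NE, map_add, two_smul]; abel

lemma Lop_smul (c : ℝ) (y : SForm n) : Lop n (c • y) = c • Lop n y := by
  simp only [Lop_eq, map_smul, Finset.smul_sum]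

lemma omegaPow_succ (m : ℕ) : omegaPow n (m + 1) = Lop n (omegaPow n m) := by
  simp [omegaPow, Lpow, Function.iterate_succ_apply']

lemma N_omegaPow (m : ℕ) : N (omegaPow n m) = (2 * m : ℝ) • omegaPow n m := by
  induction m with
  | zero => simp [omegaPow, Lpow, N_one]
  | succ m ih =>
    rw [omegaPow_succ, N_L, ih, Lop_smul, ← add_smul]; push_cast; ring_nf

lemma Lm_omegaPow (m : ℕ) :
    Lm (omegaPow n (m + 1)) = ((m + 1 : ℝ) * (n - m)) • omegaPow n m := by
  induction m with
  | zero =>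
    rw [omegaPow_succ, Lm_L, N_omegaPow]
    have : Lm (omegaPow n 0) = 0 := by
      simp [omegaPow, Lpow, Lm_apply, I_one]
    rw [this]
    have : Lop n 0 = 0 := by simp [Lop_eq]
    simp [this]
  | succ m ih =>
    rw [omegaPow_succ, Lm_L, ih, Lop_smul, ← omegaPow_succ, N_omegaPow, ← sub_smul, ← add_smul]
    congr 1; push_cast; ring

lemma sip_smul_right (c : ℝ) (x y : SForm n) : sip x (c • y) = c * sip x y := by
  simp only [sip, Finset.mul_sum, Pi.smul_apply, smul_eq_mul]
  exact Finset.sum_congr rfl fun _ _ => by ring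

lemma sip_omegaPow (m : ℕ) (hm : m ≤ n) :
    sip (omegaPow n m) (omegaPow n m) * (n - m).factorial = m.factorial * n.factorial := by
  induction m with
  | zero => simp [omegaPow, Lpow, sip, sOne]
  | succ m ih =>
    have ih := ih (by omega)
    conv_lhs => rw [omegaPow_succ]
    rw [sip_L, ← omegaPow_succ, Lm_omegaPow, sip_smul_right]
    have h : n - m = (n - (m + 1)) + 1 := by omega
    rw [h, Nat.factorial_succ] at ih
    have h2 : ((n - (m + 1) : ℕ) : ℝ) = n - m - 1 := by
      rw [Nat.cast_sub hm]; push_cast; ring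
    rw [Nat.factorial_succ]
    push_cast at ih ⊢
    rw [h2] at ih
    linear_combination (m + 1 : ℝ) * ih

lemma omegaTop_supp (s : Finset (Fin (2 * n))) (hs : s ≠ Finset.univ) : omegaTop n s = 0 := by
  have h : IsForm (2 * n) (omegaPow n n) := by
    rw [isForm_iff, N_omegaPow]; push_cast; rfl
  by_contra h2
  have h3 : omegaPow n n s ≠ 0 := by
    intro h3; apply h2; simp [omegaTop, h3]
  exact hs (Finset.card_eq_iff_eq_univ s |>.1 (by simpa using h s h3))

lemma omegaTop_sq : omegaTop n Finset.univ * omegaTop n Finset.univ = 1 := by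
  have h := sip_omegaPow (n := n) n le_rfl
  have hf : (n.factorial : ℝ) ≠ 0 := by positivity
  have h1 : ∀ s, omegaPow n n s = n.factorial * omegaTop n s := by
    intro s; simp [omegaTop, hf]
  rw [sip, Finset.sum_eq_single Finset.univ] at h
  · rw [h1] at h
    simp at h
    have : (n.factorial * n.factorial : ℝ) * (omegaTop n Finset.univ * omegaTop n Finset.univ) =
      n.factorial * n.factorial * 1 := by linear_combination h
    exact mul_left_cancel₀ (by positivity) this
  · intro s _ hs; rw [h1, omegaTop_supp s hs]; simp
  · simp

/-- sign of the pair `(s, sᶜ)` -/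
def sgc {m : ℕ} (s : Finset (Fin m)) : ℝ :=
  (-1 : ℝ) ^ (((s ×ˢ sᶜ).filter fun q => q.2 < q.1).card)

lemma sgc_sq {m : ℕ} (s : Finset (Fin m)) : sgc s * sgc s = 1 := by
  unfold sgc; rw [← pow_add, ← two_mul, pow_mul]; simp

lemma sgc_compl (s : Finset (Fin (2 * n))) : sgc s * sgc sᶜ = (-1) ^ s.card := by
  unfold sgc
  rw [← pow_add, compl_compl]
  have h : (((sᶜ ×ˢ s).filter fun q => q.2 < q.1).card) =
      (((s ×ˢ sᶜ).filter fun q => ¬ q.2 < q.1).card) := by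
    refine Finset.card_bij' (fun q _ => q.swap) (fun q _ => q.swap) ?_ ?_ ?_ ?_
    · rintro ⟨p, q⟩ h; simp at h ⊢; exact ⟨⟨h.1.2, h.1.1⟩, h.2.le⟩
    · rintro ⟨p, q⟩ h; simp at h ⊢
      refine ⟨⟨h.1.2, h.1.1⟩, lt_of_le_of_ne h.2 ?_⟩
      rintro rfl; exact h.1.2 h.1.1
    · intros; simp
    · intros; simp
  rw [h, Finset.card_filter_add_card_filter_not, Finset.card_product, Finset.card_compl,
    Fintype.card_fin]
  have hle : s.card ≤ 2 * n := by simpa using Finset.card_le_univ s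
  rcases Nat.even_or_odd s.card with h | h
  · rw [h.neg_one_pow, (h.mul_right _).neg_one_pow]
  · rw [h.neg_one_pow, (h.mul (Nat.Even.sub_odd hle (by simp) h)).neg_one_pow]

lemma sgc_insert {m : ℕ} (a : Fin m) (s : Finset (Fin m)) (ha : a ∉ s) :
    sgc (insert a s) * sg a (insert a s) = sgc s * sg a (insert a s)ᶜ * (-1) ^ s.card := by
  set u := (insert a s)ᶜ with hu
  have hau : a ∉ u := by simp [hu]
  have hsu : sᶜ = insert a u := by
    ext b; simp [hu]; by_cases hb : b = a <;> simp [hb, ha]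
  have h1 : sgc (insert a s) = sg a u * (-1 : ℝ) ^ (((s ×ˢ u).filter fun q => q.2 < q.1).card) := by
    unfold sgc sg
    rw [← hu, Finset.insert_eq, Finset.union_product, Finset.filter_union,
      Finset.card_union_of_disjoint, pow_add]
    · simp only [Finset.singleton_product, Finset.filter_map, Finset.card_map]; rfl
    · rw [Finset.disjoint_left]; simp; intros; simp_all
  have h2 : sgc s = (-1) ^ ((s.filter (a < ·)).card) *
      (-1 : ℝ) ^ (((s ×ˢ u).filter fun q => q.2 < q.1).card) := by
    unfold sgc
    rw [hsu, Finset.insert_eq, Finset.product_union, Finset.filter_union,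
      Finset.card_union_of_disjoint, pow_add]
    · simp only [Finset.product_singleton, Finset.filter_map, Finset.card_map]; rfl
    · rw [Finset.disjoint_left]; simp; intros; simp_all
  have h3 : (s.filter (a < ·)).card + (s.filter (· < a)).card = s.card := by
    rw [← Finset.card_filter_add_card_filter_not (s := s) (fun b => a < b)]
    congr 2
    ext b; simp only [Finset.mem_filter, not_lt]
    refine and_congr_right fun hb => ⟨le_of_lt, fun h => lt_of_le_of_ne h ?_⟩
    rintro rfl; exact ha hb
  rw [sg_insert_self, h1, h2, ← h3, pow_add]
  have h4 : ((-1 : ℝ) ^ ((s.filter (a < ·)).card)) * ((-1 : ℝ) ^ ((s.filter (a < ·)).card)) = 1 := by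
    rw [← pow_add, ← two_mul, pow_mul]; simp
  unfold sg
  linear_combination (-(-1 : ℝ) ^ (u.filter (· < a)).card * (-1 : ℝ) ^ (s.filter (· < a)).card *
    (-1 : ℝ) ^ (((s ×ˢ u).filter fun q => q.2 < q.1).card)) * h4

/-- the plain Hodge star -/
def St : SForm n →ₗ[ℝ] SForm n where
  toFun y := fun t => omegaTop n Finset.univ * sgc tᶜ * y tᶜ
  map_add' x y := by ext s; simp only [Pi.add_apply]; ring
  map_smul' c y := by
    ext s; simp only [Pi.smul_apply, smul_eq_mul, RingHom.id_apply]; ring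

lemma St_apply (y : SForm n) (t) : St y t = omegaTop n Finset.univ * sgc tᶜ * y tᶜ := rfl

lemma St_one : St (sOne n) = omegaTop n := by
  ext t
  rw [St_apply]
  by_cases h : t = Finset.univ
  · subst h; simp [sgc, sOne]
  · rw [omegaTop_supp t h]
    simp [sOne, h]

lemma St_St (y : SForm n) : St (St y) = P y := by
  ext t
  simp only [St_apply, P_apply, compl_compl]
  rw [← sgc_compl]
  linear_combination (sgc tᶜ * sgc t * y t) * omegaTop_sq (n := n)

lemma St_E (a : Fin (2 * n)) (y : SForm n) : St (E a y) = I a (St (P y)) := by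
  ext t
  simp only [St_apply, E_apply, I_apply, P_apply]
  by_cases ha : a ∈ t
  · simp [ha]
  · have hi : tᶜ = insert a (insert a t)ᶜ := by
      ext b; simp; by_cases hb : b = a <;> simp [hb, ha]
    have h := sgc_insert a (insert a t)ᶜ (by simp)
    rw [← hi, compl_compl] at h
    have he : tᶜ.erase a = (insert a t)ᶜ := by
      ext b; simp
    simp only [Finset.mem_compl, ha, not_false_eq_true, if_true, if_false, he]
    linear_combination (omegaTop n Finset.univ * y (insert a t)ᶜ) * h

lemma St_P (y : SForm n) : St (P y) = P (St y) := by
  rw [← St_St, ← St_St]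

lemma J_J (J : SForm n →ₗ[ℝ] SForm n) (h1 : J (sOne n) = sOne n)
    (hx : ∀ i y, J (E (dxI n i) y) = E (dxiI n i) (J y))
    (hxi : ∀ i y, J (E (dxiI n i) y) = E (dxI n i) (J y))
    (y : SForm n) : J (J y) = y := by
  refine gen_eq (J ∘ₗ J) LinearMap.id (by simp [h1]) ?_ y
  intro a y hy
  simp at hy ⊢
  rcases idx_cases a with ⟨i, rfl⟩ | ⟨i, rfl⟩ <;> simp only [hx, hxi, hy]

lemma J_N (J : SForm n →ₗ[ℝ] SForm n) (h1 : J (sOne n) = sOne n)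
    (hx : ∀ i y, J (E (dxI n i) y) = E (dxiI n i) (J y))
    (hxi : ∀ i y, J (E (dxiI n i) y) = E (dxI n i) (J y))
    (y : SForm n) : J (N y) = N (J y) := by
  refine gen_eq (J ∘ₗ N) (N ∘ₗ J) (by simp [h1, N_one]) ?_ y
  intro a y hy
  simp at hy ⊢
  rcases idx_cases a with ⟨i, rfl⟩ | ⟨i, rfl⟩ <;> simp only [hx, hxi, NE, map_add, hy]

lemma J_P (J : SForm n →ₗ[ℝ] SForm n) (h1 : J (sOne n) = sOne n)
    (hx : ∀ i y, J (E (dxI n i) y) = E (dxiI n i) (J y))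
    (hxi : ∀ i y, J (E (dxiI n i) y) = E (dxI n i) (J y))
    (y : SForm n) : J (P y) = P (J y) := by
  refine gen_eq (J ∘ₗ P) (P ∘ₗ J) (by simp [h1, P_one]) ?_ y
  intro a y hy
  simp at hy ⊢
  rcases idx_cases a with ⟨i, rfl⟩ | ⟨i, rfl⟩ <;> simp only [hx, hxi, PE, map_neg, hy]

lemma J_form (J : SForm n →ₗ[ℝ] SForm n) (h1 : J (sOne n) = sOne n)
    (hx : ∀ i y, J (E (dxI n i) y) = E (dxiI n i) (J y))
    (hxi : ∀ i y, J (E (dxiI n i) y) = E (dxI n i) (J y))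
    (k : ℕ) (y : SForm n) (h : IsForm k y) : IsForm k (J y) := by
  rw [isForm_iff] at h ⊢
  rw [← J_N J h1 hx hxi, h, map_smul]

lemma J_Ix (J : SForm n →ₗ[ℝ] SForm n) (h1 : J (sOne n) = sOne n)
    (hx : ∀ i y, J (E (dxI n i) y) = E (dxiI n i) (J y))
    (hxi : ∀ i y, J (E (dxiI n i) y) = E (dxI n i) (J y))
    (i : Fin n) (y : SForm n) : J (I (dxI n i) y) = I (dxiI n i) (J y) := by
  refine gen_eq (J ∘ₗ I (dxI n i)) (I (dxiI n i) ∘ₗ J) (by simp [h1, I_one]) ?_ y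
  intro a y hy
  simp at hy ⊢
  rcases idx_cases a with ⟨j, rfl⟩ | ⟨j, rfl⟩
  · by_cases h : i = j
    · subst h
      rw [IE_self, hx, IE_self, map_sub, hx, hy]
    · rw [IE_ne _ _ (mt dx_inj.1 h), hx, IE_ne _ _ (mt dxi_inj.1 h), map_neg, hx, hy]
  · rw [IE_ne _ _ (dx_ne_dxi _ _), hxi, IE_ne _ _ (dx_ne_dxi _ _).symm, map_neg, hxi, hy]

lemma J_Ixi (J : SForm n →ₗ[ℝ] SForm n) (h1 : J (sOne n) = sOne n)
    (hx : ∀ i y, J (E (dxI n i) y) = E (dxiI n i) (J y))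
    (hxi : ∀ i y, J (E (dxiI n i) y) = E (dxI n i) (J y))
    (i : Fin n) (y : SForm n) : J (I (dxiI n i) y) = I (dxI n i) (J y) := by
  have := J_Ix J h1 hx hxi i (J y)
  rw [J_J J h1 hx hxi] at this
  rw [← this, J_J J h1 hx hxi]

lemma J_L (J : SForm n →ₗ[ℝ] SForm n) (h1 : J (sOne n) = sOne n)
    (hx : ∀ i y, J (E (dxI n i) y) = E (dxiI n i) (J y))
    (hxi : ∀ i y, J (E (dxiI n i) y) = E (dxI n i) (J y))
    (y : SForm n) : J (Lop n y) = - Lop n (J y) := by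
  rw [Lop_eq, Lop_eq, map_sum, ← Finset.sum_neg_distrib]
  refine Finset.sum_congr rfl fun i _ => ?_
  rw [hx, hxi, EE _ _ (dx_ne_dxi _ _).symm]

lemma J_omegaPow (J : SForm n →ₗ[ℝ] SForm n) (h1 : J (sOne n) = sOne n)
    (hx : ∀ i y, J (E (dxI n i) y) = E (dxiI n i) (J y))
    (hxi : ∀ i y, J (E (dxiI n i) y) = E (dxI n i) (J y))
    (m : ℕ) : J (omegaPow n m) = (-1 : ℝ) ^ m • omegaPow n m := by
  induction m with
  | zero => simp [omegaPow, Lpow, h1]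
  | succ m ih => rw [omegaPow_succ, J_L J h1 hx hxi, ih, Lop_smul, pow_succ]; simp

lemma J_omegaTop (J : SForm n →ₗ[ℝ] SForm n) (h1 : J (sOne n) = sOne n)
    (hx : ∀ i y, J (E (dxI n i) y) = E (dxiI n i) (J y))
    (hxi : ∀ i y, J (E (dxiI n i) y) = E (dxI n i) (J y))
    : J (omegaTop n) = (-1 : ℝ) ^ n • omegaTop n := by
  rw [omegaTop, map_smul, J_omegaPow J h1 hx hxi, smul_comm]

lemma J_St_J (J : SForm n →ₗ[ℝ] SForm n) (h1 : J (sOne n) = sOne n)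
    (hx : ∀ i y, J (E (dxI n i) y) = E (dxiI n i) (J y))
    (hxi : ∀ i y, J (E (dxiI n i) y) = E (dxI n i) (J y))
    (y : SForm n) : J (St (J y)) = (-1 : ℝ) ^ n • St y := by
  refine gen_eq (J ∘ₗ St ∘ₗ J) ((-1 : ℝ) ^ n • St) ?_ ?_ y
  · simp [h1, St_one, J_omegaTop J h1 hx hxi]
  · intro a y hy
    simp only [LinearMap.comp_apply, LinearMap.smul_apply] at hy ⊢
    rw [St_E, St_P, ← map_smul, ← map_smul, ← hy]
    rcases idx_cases a with ⟨j, rfl⟩ | ⟨j, rfl⟩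
    · rw [hx, St_E, J_Ixi J h1 hx hxi, St_P, J_P J h1 hx hxi]
    · rw [hxi, St_E, J_Ix J h1 hx hxi, St_P, J_P J h1 hx hxi]

/-- the Hodge star of the statement is `St ∘ J`. -/
lemma hodge_eq (J : SForm n →ₗ[ℝ] SForm n) (h1 : J (sOne n) = sOne n)
    (hx : ∀ i y, J (E (dxI n i) y) = E (dxiI n i) (J y))
    (hxi : ∀ i y, J (E (dxiI n i) y) = E (dxI n i) (J y))
    (hodge : SForm n →ₗ[ℝ] SForm n)
    (hodgeDeg : ∀ (k : ℕ) (x : SForm n), IsForm k x → IsForm (2 * n - k) (hodge x))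
    (hodgeChar : ∀ (k : ℕ) (x y : SForm n), IsForm k x → IsForm k y →
        wedge x (hodge y) = sip x (J y) • omegaTop n) (y : SForm n) :
    hodge y = St (J y) := by
  have single_form : ∀ s : Finset (Fin (2 * n)), IsForm s.card (Pi.single s 1 : SForm n) := by
    intro s t ht
    by_cases h : t = s
    · rw [h]
    · simp [h] at ht
  have key : ∀ (k : ℕ) (y : SForm n), IsForm k y → hodge y = St (J y) := by
    intro k y hy
    ext t
    rw [St_apply]
    have hle : t.card ≤ 2 * n := by simpa using Finset.card_le_univ t
    have hc : tᶜ.card = 2 * n - t.card := by rw [Finset.card_compl, Fintype.card_fin]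
    by_cases hk : tᶜ.card = k
    · have h := congrFun (hodgeChar k _ y (hk ▸ single_form tᶜ) hy) Finset.univ
      rw [wedge_single, if_pos (Finset.subset_univ _), sip_single, ← Finset.compl_eq_univ_sdiff,
        Pi.smul_apply, smul_eq_mul] at h
      have hh : sgc tᶜ * hodge y t = J y tᶜ * omegaTop n Finset.univ := by
        rw [← h, sgc, compl_compl]
      linear_combination sgc tᶜ * hh - hodge y t * sgc_sq tᶜ
    · have e1 : J y tᶜ = 0 := by
        by_contra h
        exact hk (J_form J h1 hx hxi k y hy _ h)
      rw [e1, mul_zero]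
      by_contra h
      have h3 := hodgeDeg k y hy _ h
      by_cases hkn : k ≤ 2 * n
      · omega
      · apply h
        have : y = 0 := by
          ext u
          by_contra hu
          have := hy u hu
          have hle : u.card ≤ 2 * n := by simpa using Finset.card_le_univ u
          omega
        rw [this, map_zero]; rfl
  rw [form_eq_sum y]
  simp only [map_sum, map_smul]
  exact Finset.sum_congr rfl fun s _ => by rw [key _ _ (single_form s)]


end SAux

/-- for every smooth super form `α` on `ℝⁿ` (flat metric
`ω = Σ dx_i ∧ dξ_i`), `[Λ, d]α = (−1)ⁿ * d * α`, where `Λ` is the adjoint of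
`L = ω ∧ ·`, `J` the algebra automorphism exchanging `dx_i` and `dξ_i`, and the
Hodge star the (unique) linear map sending `k`-forms to `(2n−k)`-forms with
`α ∧ *β = ⟨α, Jβ⟩ ω_n` for `k`-forms `α, β`; all acting on super forms pointwise. -/
theorem commutator_Lambda_d_eq_star_d_star (n : ℕ) (hn : 1 ≤ n)
    (Lam : SForm n →ₗ[ℝ] SForm n)
    (hLam : ∀ x y : SForm n, sip (Lop n x) y = sip x (Lam y))
    (Jop : SForm n →ₗ[ℝ] SForm n)
    (hJone : Jop (sOne n) = sOne n)
    (hJmul : ∀ x y : SForm n, Jop (wedge x y) = wedge (Jop x) (Jop y))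
    (hJdx : ∀ i, Jop (sDx n i) = sDxi n i)
    (hJdxi : ∀ i, Jop (sDxi n i) = sDx n i)
    (hodge : SForm n →ₗ[ℝ] SForm n)
    (hodgeDeg : ∀ (k : ℕ) (x : SForm n), IsForm k x → IsForm (2 * n - k) (hodge x))
    (hodgeChar : ∀ (k : ℕ) (x y : SForm n), IsForm k x → IsForm k y →
        wedge x (hodge y) = sip x (Jop y) • omegaTop n)
    (α : (Fin n → ℝ) → SForm n) (hα : ContDiff ℝ (⊤ : ℕ∞) α) (x : Fin n → ℝ) :
    Lam (dS n α x) - dS n (fun y => Lam (α y)) x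
      = ((-1 : ℝ) ^ n) • hodge (dS n (fun y => hodge (α y)) x) := by
  have hx : ∀ i y, Jop (SAux.E (dxI n i) y) = SAux.E (dxiI n i) (Jop y) := by
    intro i y
    rw [← SAux.wedge_dx, hJmul, hJdx, SAux.wedge_dxi]
  have hxi : ∀ i y, Jop (SAux.E (dxiI n i) y) = SAux.E (dxI n i) (Jop y) := by
    intro i y
    rw [← SAux.wedge_dxi, hJmul, hJdxi, SAux.wedge_dx]
  have hst := SAux.hodge_eq Jop hJone hx hxi hodge hodgeDeg hodgeChar
  have hd : ∀ (T : SForm n →ₗ[ℝ] SForm n) (v : Fin n → ℝ),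
      fderiv ℝ (fun y => T (α y)) x v = T (fderiv ℝ α x v) := by
    intro T v
    have h1 : DifferentiableAt ℝ α x := (hα.differentiable (by simp)).differentiableAt
    have h2 := ((LinearMap.toContinuousLinearMap T).hasFDerivAt (x := α x)).comp x h1.hasFDerivAt
    have h3 : fderiv ℝ (fun y => T (α y)) x = _ := h2.fderiv
    rw [h3]; rfl
  simp only [dS, hd, SAux.wedge_dx, map_sum, Finset.smul_sum, ← Finset.sum_sub_distrib]
  refine Finset.sum_congr rfl fun i _ => ?_
  generalize fderiv ℝ α x (Pi.single i 1) = v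
  rw [SAux.Lm_unique Lam hLam, SAux.Lm_unique Lam hLam, SAux.Lm_dx, hst, hst, hx,
    SAux.J_St_J Jop hJone hx hxi, map_smul, map_smul, smul_smul, ← mul_pow, SAux.St_E,
    SAux.St_P, SAux.St_St, SAux.P_P]
  simp
end
end

section
/- Let φ : ℝⁿ → ℝ be smooth. Then for every smooth compactly supported super form α on ℝⁿ (flat ℝ-Kähler metric ω = Σ dx_i∧dξ_i): ‖(Λd#_φ − d#_φΛ)α‖²_φ + ‖dα‖²_φ = ‖(Λd − dΛ)α‖²_φ + ‖d#_φα‖²_φ + ∫_{ℝⁿ} ⟨(dd#φ ∧ (Λα) − Λ(dd#φ ∧ α))(x), α(x)⟩ e^{−φ(x)} dx, where ‖γ‖²_φ = ∫_{ℝⁿ} |γ(x)|² e^{−φ(x)} dx. -/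
open scoped BigOperators

noncomputable section

/-- `d#φ = Σ_i (∂φ/∂x_i) dξ_i` for a function `φ : ℝⁿ → ℝ`. -/
def dShFun (n : ℕ) (φ : (Fin n → ℝ) → ℝ) : (Fin n → ℝ) → SForm n :=
  fun x => ∑ i : Fin n, (fderiv ℝ φ x (Pi.single i 1)) • sDxi n i

/-- The twisted differential `d#_φ α = d#α − d#φ ∧ α`. -/
def dShPhi (n : ℕ) (φ : (Fin n → ℝ) → ℝ) (α : (Fin n → ℝ) → SForm n) :
    (Fin n → ℝ) → SForm n :=
  fun x => dSh n α x - wedge (dShFun n φ x) (α x)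

/-- `dd#φ = Σ_{i,j} (∂²φ/∂x_i∂x_j) dx_i ∧ dξ_j`. -/
def ddShFun (n : ℕ) (φ : (Fin n → ℝ) → ℝ) : (Fin n → ℝ) → SForm n :=
  fun x => ∑ i : Fin n, ∑ j : Fin n,
    (fderiv ℝ (fun y => fderiv ℝ φ y (Pi.single j 1)) x (Pi.single i 1))
      • wedge (sDx n i) (sDxi n j)

open MeasureTheory

/-- Sign of moving the index `k` into its place in `s`. -/
def sgnK {n : ℕ} (k : Fin (2 * n)) (s : Finset (Fin (2 * n))) : ℝ :=
  (-1 : ℝ) ^ (s.filter fun l => l < k).card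

/-- Creation operator. -/
def crE {n : ℕ} (k : Fin (2 * n)) : Module.End ℝ (SForm n) where
  toFun y := fun s => if k ∈ s then sgnK k s * y (s.erase k) else 0
  map_add' x y := by
    ext s; simp only [Pi.add_apply]; split_ifs <;> ring
  map_smul' c y := by
    ext s; simp only [Pi.smul_apply, smul_eq_mul, RingHom.id_apply]; split_ifs <;> ring

/-- Annihilation operator. -/
def anA {n : ℕ} (k : Fin (2 * n)) : Module.End ℝ (SForm n) where
  toFun y := fun s => if k ∈ s then 0 else sgnK k s * y (insert k s)
  map_add' x y := by
    ext s; simp only [Pi.add_apply]; split_ifs <;> ring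
  map_smul' c y := by
    ext s; simp only [Pi.smul_apply, smul_eq_mul, RingHom.id_apply]; split_ifs <;> ring

lemma crE_apply {n : ℕ} (k : Fin (2 * n)) (y : SForm n) (s) :
    crE k y s = if k ∈ s then sgnK k s * y (s.erase k) else 0 := rfl

lemma anA_apply {n : ℕ} (k : Fin (2 * n)) (y : SForm n) (s) :
    anA k y s = if k ∈ s then 0 else sgnK k s * y (insert k s) := rfl

lemma sgnK_sq {n : ℕ} (k : Fin (2 * n)) (s : Finset (Fin (2 * n))) :
    sgnK k s * sgnK k s = 1 := by
  unfold sgnK; rw [← pow_add, ← two_mul, pow_mul]; simp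

lemma sgnK_insert {n : ℕ} (k l : Fin (2 * n)) (s : Finset (Fin (2 * n))) (h : l ∉ s) :
    sgnK k (insert l s) = if l < k then - sgnK k s else sgnK k s := by
  unfold sgnK
  rw [Finset.filter_insert]
  split_ifs with h1
  · rw [Finset.card_insert_of_notMem (by simp [h]), pow_succ]; ring
  · rfl

lemma sgnK_erase {n : ℕ} (k l : Fin (2 * n)) (s : Finset (Fin (2 * n))) (h : l ∈ s) :
    sgnK k (s.erase l) = if l < k then - sgnK k s else sgnK k s := by
  have := sgnK_insert k l (s.erase l) (by simp)
  rw [Finset.insert_erase h] at this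
  rw [this]; split_ifs <;> simp

lemma sip_crE {n : ℕ} (k : Fin (2 * n)) (x y : SForm n) :
    sip (crE k x) y = sip x (anA k y) := by
  unfold sip
  simp only [crE_apply, anA_apply]
  have h1 : ∀ s : Finset (Fin (2 * n)), (if k ∈ s then sgnK k s * x (s.erase k) else 0) * y s
      = if k ∈ s then sgnK k s * x (s.erase k) * y s else 0 := by
    intro s; split_ifs <;> simp
  have h2 : ∀ s : Finset (Fin (2 * n)), x s * (if k ∈ s then 0 else sgnK k s * y (insert k s))
      = if k ∉ s then x s * (sgnK k s * y (insert k s)) else 0 := by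
    intro s; by_cases h : k ∈ s <;> simp [h]
  simp only [h1, h2]
  rw [← Finset.sum_filter, ← Finset.sum_filter]
  refine Finset.sum_nbij' (fun s => s.erase k) (fun s => insert k s) ?_ ?_ ?_ ?_ ?_
  · intro s hs; simp
  · intro s hs; simp
  · intro s hs; simp at hs; simp [Finset.insert_erase hs]
  · intro s hs; simp at hs; simp [Finset.erase_insert hs]
  · intro s hs; simp at hs
    simp only [sgnK_erase k k s hs, Finset.insert_erase hs]; simp; ring

lemma sip_comm {n : ℕ} (x y : SForm n) : sip x y = sip y x := by
  unfold sip; exact Finset.sum_congr rfl fun s _ => mul_comm _ _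

lemma car_EE {n : ℕ} (k l : Fin (2 * n)) : crE k * crE l = - (crE l * crE k) := by
  refine LinearMap.ext fun y => funext fun s => ?_
  simp only [Module.End.mul_apply, LinearMap.neg_apply, Pi.neg_apply, crE_apply]
  rcases eq_or_ne k l with rfl | hkl
  · simp
  by_cases hk : k ∈ s <;> by_cases hl : l ∈ s <;>
    simp only [hk, hl, Finset.mem_erase, if_true, if_false, and_true, and_false, ne_eq, hkl, hkl.symm,
      not_false_eq_true, mul_zero, neg_zero]
  rw [sgnK_erase l k s hk, sgnK_erase k l s hl, Finset.erase_right_comm]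
  rcases lt_or_gt_of_ne hkl with h | h
  · simp [h, h.not_gt]; ring
  · simp [h, h.not_gt]; ring

lemma car_AE {n : ℕ} (k l : Fin (2 * n)) (hkl : k ≠ l) :
    anA k * crE l = - (crE l * anA k) := by
  refine LinearMap.ext fun y => funext fun s => ?_
  simp only [Module.End.mul_apply, LinearMap.neg_apply, Pi.neg_apply, crE_apply, anA_apply]
  by_cases hk : k ∈ s <;> by_cases hl : l ∈ s <;>
    simp only [hk, hl, Finset.mem_erase, Finset.mem_insert, if_true, if_false, and_true, and_false, ne_eq, hkl, hkl.symm,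
      not_false_eq_true, mul_zero, neg_zero, or_true, or_false]
  rw [sgnK_insert l k s hk, sgnK_erase k l s hl, Finset.erase_insert_of_ne hkl]
  rcases lt_or_gt_of_ne hkl with h | h
  · simp [h, h.not_gt]; ring
  · simp [h, h.not_gt]; ring

lemma car_AE_self {n : ℕ} (k : Fin (2 * n)) :
    anA k * crE k = 1 - (crE k * anA k) := by
  refine LinearMap.ext fun y => funext fun s => ?_
  simp only [Module.End.mul_apply, LinearMap.sub_apply, Pi.sub_apply, crE_apply, anA_apply,
    Module.End.one_apply]
  by_cases hk : k ∈ s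
  · simp only [hk, if_true, Finset.mem_erase, ne_eq, not_true, false_and, if_false,
      Finset.insert_erase hk, sgnK_erase k k s hk, lt_irrefl]
    rw [← mul_assoc, sgnK_sq]; ring
  · simp only [hk, if_false, Finset.mem_insert, true_or, if_true, Finset.erase_insert hk,
      sgnK_insert k k s hk, lt_irrefl]
    rw [← mul_assoc, sgnK_sq]; ring

lemma wedge_single {n : ℕ} (k : Fin (2 * n)) (y : SForm n) :
    wedge (fun s => if s = {k} then 1 else 0) y = crE k y := by
  funext s
  rw [crE_apply]
  unfold wedge
  split_ifs with h
  · rw [Finset.sum_eq_single {k}]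
    · simp only [if_true, mul_one, Finset.sdiff_singleton_eq_erase]
      congr 1
      unfold sgnK
      congr 1
      refine Finset.card_nbij' (fun q => q.2) (fun l => (k, l)) ?_ ?_ ?_ ?_
      · intro q; simp; grind
      · intro q; simp; grind
      · intro q; simp; grind
      · intro q; simp
    · intro b _ hb; simp [hb]
    · intro hh; simp [h] at hh
  · refine Finset.sum_eq_zero fun a ha => ?_
    have : a ≠ {k} := by
      rintro rfl; simp at ha; exact h ha
    simp [this]

lemma wedge_pair {n : ℕ} (p q : Fin (2 * n)) (hpq : p < q) (y : SForm n) :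
    wedge (fun s => if s = {p, q} then 1 else 0) y = crE p (crE q y) := by
  funext s
  simp only [crE_apply]
  unfold wedge
  by_cases h : ({p, q} : Finset _) ⊆ s
  · have hp : p ∈ s := h (by simp)
    have hq : q ∈ s := h (by simp)
    rw [Finset.sum_eq_single {p, q}]
    · simp only [if_true, mul_one, hp, Finset.mem_erase, hq, hpq.ne', ne_eq, not_false_eq_true,
        and_self]
      rw [← mul_assoc]
      have e : s \ {p, q} = (s.erase p).erase q := by ext; simp; tauto
      rw [e]
      congr 1
      have c1 : sgnK p s = sgnK p ((s.erase p).erase q) := by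
        rw [sgnK_erase p q (s.erase p) (Finset.mem_erase.2 ⟨hpq.ne', hq⟩), sgnK_erase p p s hp]; simp [hpq.not_gt]
      have c2 : sgnK q (s.erase p) = sgnK q ((s.erase p).erase q) := by
        rw [sgnK_erase q q (s.erase p) (Finset.mem_erase.2 ⟨hpq.ne', hq⟩)]; simp
      rw [c1, c2]
      unfold sgnK
      rw [← pow_add]
      congr 1
      generalize (s.erase p).erase q = t
      have : ({p, q} : Finset (Fin (2*n))) ×ˢ t = ({p} ×ˢ t) ∪ ({q} ×ˢ t) := by
        ext ⟨a, b⟩; simp only [Finset.mem_product, Finset.mem_union, Finset.mem_insert, Finset.mem_singleton]; tauto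
      rw [this, Finset.filter_union, Finset.card_union_of_disjoint]
      · congr 1
        · refine Finset.card_nbij' (fun q => q.2) (fun l => (p, l)) ?_ ?_ ?_ ?_ <;> intro q <;> simp <;> grind
        · refine Finset.card_nbij' (fun q => q.2) (fun l => (q, l)) ?_ ?_ ?_ ?_ <;> intro q <;> simp <;> grind
      · rw [Finset.disjoint_left]; intro a; simp; grind
    · intro b _ hb; simp [hb]
    · intro hh; exact absurd (Finset.mem_powerset.2 h) hh
  · have : ¬ (p ∈ s ∧ q ∈ s) := by
      rintro ⟨a, b⟩; apply h; intro z; simp; rintro (rfl | rfl) <;> assumption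
    rw [Finset.sum_eq_zero]
    · split_ifs <;> simp_all
    · intro a ha
      have : a ≠ {p, q} := by
        rintro rfl; exact h (Finset.mem_powerset.1 ha)
      simp [this]

lemma crE_single {n : ℕ} (p q : Fin (2 * n)) (hpq : p < q) :
    crE p (fun s => if s = {q} then 1 else 0) = (fun s => if s = {p, q} then (1:ℝ) else 0) := by
  funext s
  rw [crE_apply]
  by_cases h : s = {p, q}
  · subst h
    have : ({p, q} : Finset _).erase p = {q} := by ext; simp; grind
    simp only [this]
    simp [sgnK]
    rw [Finset.filter_insert, Finset.filter_singleton]; simp [hpq.not_gt]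
  · simp only [h, if_false]
    split_ifs with h1 h2
    · exfalso; apply h; rw [← Finset.insert_erase h1, h2]
    · simp
    · rfl

lemma wedge_add_left {n : ℕ} (x x' y : SForm n) : wedge (x + x') y = wedge x y + wedge x' y := by
  funext s; simp only [wedge, Pi.add_apply, ← Finset.sum_add_distrib]
  exact Finset.sum_congr rfl fun _ _ => by ring

lemma wedge_smul_left {n : ℕ} (c : ℝ) (x y : SForm n) : wedge (c • x) y = c • wedge x y := by
  funext s; simp only [wedge, Pi.smul_apply, smul_eq_mul, Finset.mul_sum]
  exact Finset.sum_congr rfl fun _ _ => by ring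

lemma wedge_sum_left {n : ℕ} {ι : Type*} (t : Finset ι) (x : ι → SForm n) (y : SForm n) :
    wedge (∑ i ∈ t, x i) y = ∑ i ∈ t, wedge (x i) y := by
  classical
  induction t using Finset.induction_on with
  | empty => funext s; simp [wedge]
  | insert a t ha ih => rw [Finset.sum_insert ha, Finset.sum_insert ha, wedge_add_left, ih]

lemma dxI_lt_dxiI {n : ℕ} (i j : Fin n) : dxI n i < dxiI n j := by
  simp only [dxI, dxiI, Fin.lt_def]; omega

lemma dxI_inj {n : ℕ} {i j : Fin n} (h : i ≠ j) : dxI n i ≠ dxI n j := by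
  simp only [dxI, ne_eq, Fin.ext_iff] at *; exact h

lemma dxiI_inj {n : ℕ} {i j : Fin n} (h : i ≠ j) : dxiI n i ≠ dxiI n j := by
  simp only [dxiI, ne_eq, Fin.ext_iff] at *; omega

lemma wedge_sDx {n : ℕ} (i : Fin n) (y : SForm n) : wedge (sDx n i) y = crE (dxI n i) y :=
  wedge_single _ _

lemma wedge_sDxi {n : ℕ} (i : Fin n) (y : SForm n) : wedge (sDxi n i) y = crE (dxiI n i) y :=
  wedge_single _ _

lemma wedge_two {n : ℕ} (i j : Fin n) (y : SForm n) :
    wedge (wedge (sDx n i) (sDxi n j)) y = crE (dxI n i) (crE (dxiI n j) y) := by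
  rw [wedge_sDx]
  unfold sDxi
  rw [crE_single _ _ (dxI_lt_dxiI i j), wedge_pair _ _ (dxI_lt_dxiI i j)]

/-- `sip` as a bilinear map. -/
def sipB (n : ℕ) : SForm n →ₗ[ℝ] SForm n →ₗ[ℝ] ℝ :=
  LinearMap.mk₂ ℝ sip
    (by intro a b c; simp only [sip, Pi.add_apply, add_mul, Finset.sum_add_distrib])
    (by intro a b c; simp only [sip, Pi.smul_apply, smul_eq_mul, mul_assoc, Finset.mul_sum])
    (by intro a b c; simp only [sip, Pi.add_apply, mul_add, Finset.sum_add_distrib])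
    (by intro a b c; simp only [sip, Pi.smul_apply, smul_eq_mul, Finset.mul_sum]
        exact Finset.sum_congr rfl fun _ _ => by ring)

lemma sipB_apply {n : ℕ} (x y : SForm n) : sipB n x y = sip x y := rfl

lemma sip_ext {n : ℕ} (y z : SForm n) (h : ∀ x, sip x y = sip x z) : y = z := by
  funext s
  have := h (Pi.single s 1)
  simpa [sip, Pi.single_apply] using this

lemma Lam_eq {n : ℕ} (Lam : SForm n →ₗ[ℝ] SForm n)
    (hLam : ∀ x y : SForm n, sip (Lop n x) y = sip x (Lam y)) :
    (Lam : Module.End ℝ (SForm n)) = ∑ i : Fin n, anA (dxiI n i) * anA (dxI n i) := by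
  refine LinearMap.ext fun y => sip_ext _ _ fun x => ?_
  rw [← hLam, Lop, omegaF, wedge_sum_left]
  simp only [wedge_two, LinearMap.sum_apply, Module.End.mul_apply]
  simp only [← sipB_apply, map_sum, LinearMap.sum_apply]
  simp only [sipB_apply, sip_crE]

lemma ring_aux1 {R : Type*} [Ring R] (a b e : R) (h1 : b * e = 1 - e * b)
    (h2 : a * e = -(e * a)) : a * b * e - e * (a * b) = a := by
  rw [mul_assoc, h1, mul_sub, ← mul_assoc, h2]; noncomm_ring

lemma ring_aux2 {R : Type*} [Ring R] (a b e : R) (h1 : b * e = -(e * b))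
    (h2 : a * e = -(e * a)) : a * b * e - e * (a * b) = 0 := by
  rw [mul_assoc, h1, mul_neg, ← mul_assoc, h2]; noncomm_ring

lemma ring_aux3 {R : Type*} [Ring R] (a b e : R) (h1 : b * e = -(e * b))
    (h2 : a * e = 1 - (e * a)) : a * b * e - e * (a * b) = -b := by
  rw [mul_assoc, h1, mul_neg, ← mul_assoc, h2]; noncomm_ring

lemma Lam_comm_E {n : ℕ} (Lam : Module.End ℝ (SForm n))
    (hLam : Lam = ∑ i : Fin n, anA (dxiI n i) * anA (dxI n i)) (i : Fin n) :
    Lam * crE (dxI n i) - crE (dxI n i) * Lam = anA (dxiI n i) := by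
  rw [hLam, Finset.sum_mul, Finset.mul_sum, ← Finset.sum_sub_distrib, Finset.sum_eq_single i]
  · have h1 := car_AE_self (dxI n i)
    have h2 := car_AE (dxiI n i) (dxI n i) (dxI_lt_dxiI i i).ne'
    exact ring_aux1 _ _ _ h1 h2
  · intro j _ hj
    have h1 := car_AE (dxI n j) (dxI n i) (dxI_inj hj)
    have h2 := car_AE (dxiI n j) (dxI n i) (dxI_lt_dxiI i j).ne'
    exact ring_aux2 _ _ _ h1 h2
  · simp

lemma Lam_comm_F {n : ℕ} (Lam : Module.End ℝ (SForm n))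
    (hLam : Lam = ∑ i : Fin n, anA (dxiI n i) * anA (dxI n i)) (i : Fin n) :
    Lam * crE (dxiI n i) - crE (dxiI n i) * Lam = - anA (dxI n i) := by
  rw [hLam, Finset.sum_mul, Finset.mul_sum, ← Finset.sum_sub_distrib, Finset.sum_eq_single i]
  · have h1 := car_AE_self (dxiI n i)
    have h2 := car_AE (dxI n i) (dxiI n i) (dxI_lt_dxiI i i).ne
    exact ring_aux3 _ _ _ h2 h1
  · intro j _ hj
    have h1 := car_AE (dxI n j) (dxiI n i) (dxI_lt_dxiI j i).ne
    have h2 := car_AE (dxiI n j) (dxiI n i) (dxiI_inj hj)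
    exact ring_aux2 _ _ _ h1 h2
  · simp
lemma sip_crE' {n : ℕ} (k : Fin (2 * n)) (x y : SForm n) :
    sip x (crE k y) = sip (anA k x) y := by
  rw [sip_comm, sip_crE, sip_comm]

lemma sip_add_left {n : ℕ} (x y z : SForm n) : sip (x + y) z = sip x z + sip y z := by
  simp only [← sipB_apply, map_add, LinearMap.add_apply]
lemma sip_sub_left {n : ℕ} (x y z : SForm n) : sip (x - y) z = sip x z - sip y z := by
  simp only [← sipB_apply, map_sub, LinearMap.sub_apply]
lemma sip_sub_right {n : ℕ} (x y z : SForm n) : sip z (x - y) = sip z x - sip z y := by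
  simp only [← sipB_apply, map_sub]
lemma sip_neg_neg {n : ℕ} (x y : SForm n) : sip (-x) (-y) = sip x y := by
  simp only [sip, Pi.neg_apply, neg_mul_neg]
lemma sip_smul_left {n : ℕ} (c : ℝ) (x z : SForm n) : sip (c • x) z = c * sip x z := by
  simp only [← sipB_apply, map_smul, LinearMap.smul_apply, smul_eq_mul]
lemma sip_sum_left {n : ℕ} {ι : Type*} (t : Finset ι) (x : ι → SForm n) (z : SForm n) :
    sip (∑ i ∈ t, x i) z = ∑ i ∈ t, sip (x i) z := by
  simp only [← sipB_apply, map_sum, LinearMap.sum_apply]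
lemma sip_sum_right {n : ℕ} {ι : Type*} (t : Finset ι) (x : ι → SForm n) (z : SForm n) :
    sip z (∑ i ∈ t, x i) = ∑ i ∈ t, sip z (x i) := by
  simp only [← sipB_apply, map_sum]

/-- The elementary expression whose weighted integral vanishes. -/
def GG {n : ℕ} (M : Module.End ℝ (SForm n)) (bi bj ai aj α : SForm n) (h : ℝ) : ℝ :=
  sip (M bi) bj - sip (M aj) ai - h * sip (M α) α

lemma ann_cre {n : ℕ} (f : Fin n → Fin (2 * n)) (hf : ∀ i j, i ≠ j → f i ≠ f j) (i j : Fin n)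
    (y : SForm n) :
    anA (f i) (crE (f j) y) = (if i = j then y else 0) - crE (f j) (anA (f i) y) := by
  split_ifs with h
  · subst h
    have := LinearMap.congr_fun (car_AE_self (f i)) y
    simpa using this
  · have := LinearMap.congr_fun (car_AE (f i) (f j) (hf _ _ h)) y
    simpa using this

lemma pointwise_alg {n : ℕ} (Lam : Module.End ℝ (SForm n))
    (hLam : Lam = ∑ i : Fin n, anA (dxiI n i) * anA (dxI n i))
    (a b : Fin n → SForm n) (α : SForm n) (h : Fin n → Fin n → ℝ) :
    sip (∑ i, anA (dxI n i) (b i)) (∑ i, anA (dxI n i) (b i))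
      + sip (∑ i, crE (dxI n i) (a i)) (∑ i, crE (dxI n i) (a i))
      - sip (∑ i, anA (dxiI n i) (a i)) (∑ i, anA (dxiI n i) (a i))
      - sip (∑ i, crE (dxiI n i) (b i)) (∑ i, crE (dxiI n i) (b i))
      - sip ((∑ i, ∑ j, h i j • crE (dxI n i) (crE (dxiI n j) (Lam α)))
          - Lam (∑ i, ∑ j, h i j • crE (dxI n i) (crE (dxiI n j) α))) α
    = ∑ i, ∑ j, (GG (crE (dxI n j) * anA (dxI n i)) (b i) (b j) (a i) (a j) α (h i j)
        + GG (crE (dxiI n i) * anA (dxiI n j)) (b i) (b j) (a i) (a j) α (h i j)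
        - if i = j then GG 1 (b i) (b j) (a i) (a j) α (h i j) else 0) := by
  have hE := ann_cre (dxI n) (fun i j => dxI_inj)
  have hF := ann_cre (dxiI n) (fun i j => dxiI_inj)
  have cE : ∀ i y, Lam (crE (dxI n i) y) = anA (dxiI n i) y + crE (dxI n i) (Lam y) := by
    intro i y
    have := LinearMap.congr_fun (Lam_comm_E Lam hLam i) y
    simp only [LinearMap.sub_apply, Module.End.mul_apply] at this
    rw [← this]; abel
  have cF : ∀ i y, Lam (crE (dxiI n i) y) = - anA (dxI n i) y + crE (dxiI n i) (Lam y) := by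
    intro i y
    have := LinearMap.congr_fun (Lam_comm_F Lam hLam i) y
    simp only [LinearMap.sub_apply, Module.End.mul_apply, LinearMap.neg_apply] at this
    rw [← this]; abel
  simp only [map_sum, map_smul, ← Finset.sum_sub_distrib, ← smul_sub]
  simp only [sip_sum_left, sip_sum_right, sip_smul_left]
  simp only [← Finset.sum_sub_distrib, ← Finset.sum_add_distrib]
  refine Finset.sum_congr rfl fun i _ => Finset.sum_congr rfl fun j _ => ?_
  have t1 : sip (anA (dxI n j) (b j)) (anA (dxI n i) (b i))
      = sip (crE (dxI n j) (anA (dxI n i) (b i))) (b j) := by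
    rw [sip_comm, sip_crE]
  have t2 : sip (crE (dxI n j) (a j)) (crE (dxI n i) (a i))
      = (if i = j then sip (a j) (a i) else 0) - sip (crE (dxI n j) (anA (dxI n i) (a j))) (a i) := by
    rw [sip_crE', hE, sip_sub_left]; split_ifs <;> simp [sip]
  have t3 : sip (anA (dxiI n j) (a j)) (anA (dxiI n i) (a i))
      = sip (crE (dxiI n i) (anA (dxiI n j) (a j))) (a i) := by
    rw [sip_crE]
  have t4 : sip (crE (dxiI n j) (b j)) (crE (dxiI n i) (b i))
      = (if i = j then sip (b i) (b j) else 0) - sip (crE (dxiI n i) (anA (dxiI n j) (b i))) (b j) := by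
    rw [sip_comm, sip_crE', hF, sip_sub_left]; simp only [eq_comm (a := j)]; split_ifs <;> simp [sip]
  have t5 : sip (crE (dxI n i) (crE (dxiI n j) (Lam α)) - Lam (crE (dxI n i) (crE (dxiI n j) α))) α
      = sip (crE (dxI n j) (anA (dxI n i) α)) α + sip (crE (dxiI n i) (anA (dxiI n j) α)) α
        - if i = j then sip α α else 0 := by
    have u1 : sip (crE (dxI n j) (anA (dxI n i) α)) α = sip (crE (dxI n i) (anA (dxI n j) α)) α := by
      rw [sip_crE, sip_crE, sip_comm]
    have u2 : sip (crE (dxiI n i) (anA (dxiI n j) α)) α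
        = sip (crE (dxiI n j) (anA (dxiI n i) α)) α := by
      rw [sip_crE, sip_crE, sip_comm]
    rw [cE, cF, hF, u1, u2]
    simp only [map_add, map_neg, sip_sub_left, sip_add_left]
    have : sip (-(crE (dxI n i)) ((anA (dxI n j)) α)) α
      = - sip ((crE (dxI n i)) ((anA (dxI n j)) α)) α := by simp [sip]
    have this' : sip (-((crE (dxI n i)) ((anA (dxI n j)) α))) α
      = - sip ((crE (dxI n i)) ((anA (dxI n j)) α)) α := by simp [sip]
    rw [this']
    split_ifs
    · ring
    · have : sip (0 : SForm n) α = 0 := by simp [sip]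
      rw [this]; ring
  simp only [GG, Module.End.mul_apply, Module.End.one_apply]
  rw [t5]
  by_cases hij : i = j
  · subst hij
    simp only [if_true] at t1 t2 t3 t4 t5 ⊢
    linear_combination t1 + t2 - t3 - t4
  · simp only [hij, if_false] at t1 t2 t3 t4 t5 ⊢
    linear_combination t1 + t2 - t3 - t4

/-- partial derivative -/
def pd {n : ℕ} (i : Fin n) (g : (Fin n → ℝ) → ℝ) (x : Fin n → ℝ) : ℝ :=
  fderiv ℝ g x (Pi.single i 1)

lemma pd_smooth {n : ℕ} (i : Fin n) {g : (Fin n → ℝ) → ℝ} (hg : ContDiff ℝ (⊤ : ℕ∞) g) :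
    ContDiff ℝ (⊤ : ℕ∞) (pd i g) := by
  unfold pd
  exact (hg.fderiv_right (m := (⊤ : ℕ∞)) (by simp)).clm_apply contDiff_const

lemma smooth_diff {n : ℕ} {g : (Fin n → ℝ) → ℝ} (hg : ContDiff ℝ (⊤ : ℕ∞) g) (x) :
    DifferentiableAt ℝ g x := (hg.differentiable (by simp)) x

lemma pd_comm {n : ℕ} (i j : Fin n) {g : (Fin n → ℝ) → ℝ} (hg : ContDiff ℝ (⊤ : ℕ∞) g) (x) :
    pd i (pd j g) x = pd j (pd i g) x := by
  have hs : IsSymmSndFDerivAt ℝ g x := hg.contDiffAt.isSymmSndFDerivAt (by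
    rw [minSmoothness_of_isRCLikeNormedField]; exact WithTop.coe_le_coe.2 (le_top : (2 : ℕ∞) ≤ ⊤))
  have hd : DifferentiableAt ℝ (fderiv ℝ g) x :=
    ((hg.fderiv_right (m := (⊤ : ℕ∞)) (by simp)).differentiable (by simp)) x
  have key : ∀ v w : Fin n → ℝ, fderiv ℝ (fun y => fderiv ℝ g y v) x w = fderiv ℝ (fderiv ℝ g) x w v := by
    intro v w
    rw [fderiv_clm_apply hd (differentiableAt_const v)]; simp
  unfold pd
  rw [key, key]; exact hs _ _

lemma pd_hcs {n : ℕ} (i : Fin n) {g : (Fin n → ℝ) → ℝ} (hc : HasCompactSupport g) :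
    HasCompactSupport (pd i g) := hc.fderiv_apply (𝕜 := ℝ) _

lemma integral_pd {n : ℕ} (i : Fin n) {g : (Fin n → ℝ) → ℝ} (hg : ContDiff ℝ (⊤ : ℕ∞) g)
    (hc : HasCompactSupport g) : ∫ x, pd i g x = 0 := by
  have h1 : Integrable g := hg.continuous.integrable_of_hasCompactSupport hc
  have h2 : Integrable (pd i g) :=
    (pd_smooth i hg).continuous.integrable_of_hasCompactSupport (pd_hcs i hc)
  have := integral_mul_fderiv_eq_neg_fderiv_mul_of_integrable (μ := (volume : Measure (Fin n → ℝ)))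
    (f := fun _ => (1:ℝ)) (g := g) (v := Pi.single i 1) (by simp) (by simpa [pd] using! h2)
    (by simpa using h1) (fun x _ => differentiableAt_const _) (fun x _ => smooth_diff hg x)
  simpa [pd] using this

lemma pd_mul {n : ℕ} (i : Fin n) {g k : (Fin n → ℝ) → ℝ} (hg : ContDiff ℝ (⊤ : ℕ∞) g)
    (hk : ContDiff ℝ (⊤ : ℕ∞) k) (x) :
    pd i (fun y => g y * k y) x = pd i g x * k x + g x * pd i k x := by
  unfold pd
  rw [fderiv_fun_mul (smooth_diff hg x) (smooth_diff hk x)]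
  simp; ring

lemma pd_sub {n : ℕ} (i : Fin n) {g k : (Fin n → ℝ) → ℝ} (hg : ContDiff ℝ (⊤ : ℕ∞) g)
    (hk : ContDiff ℝ (⊤ : ℕ∞) k) (x) :
    pd i (fun y => g y - k y) x = pd i g x - pd i k x := by
  unfold pd
  rw [fderiv_fun_sub (smooth_diff hg x) (smooth_diff hk x)]
  simp

lemma pd_exp {n : ℕ} (i : Fin n) {φ : (Fin n → ℝ) → ℝ} (hφ : ContDiff ℝ (⊤ : ℕ∞) φ) (x) :
    pd i (fun y => Real.exp (-φ y)) x = - pd i φ x * Real.exp (-φ x) := by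
  unfold pd
  rw [fderiv_exp (smooth_diff hφ x).fun_neg, fderiv_fun_neg]
  simp; ring

lemma scalar_lemma {n : ℕ} (i j : Fin n) {u v φ : (Fin n → ℝ) → ℝ}
    (hu : ContDiff ℝ (⊤ : ℕ∞) u) (hv : ContDiff ℝ (⊤ : ℕ∞) v) (hφ : ContDiff ℝ (⊤ : ℕ∞) φ)
    (hc : HasCompactSupport u) :
    Integrable (fun x => ((pd i u x - pd i φ x * u x) * (pd j v x - pd j φ x * v x)
      - pd j u x * pd i v x - pd i (pd j φ) x * (u x * v x)) * Real.exp (-φ x)) ∧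
    ∫ x, ((pd i u x - pd i φ x * u x) * (pd j v x - pd j φ x * v x)
      - pd j u x * pd i v x - pd i (pd j φ) x * (u x * v x)) * Real.exp (-φ x) = 0 := by
  have hw : ContDiff ℝ (⊤ : ℕ∞) (fun x => Real.exp (-φ x)) := hφ.neg.exp
  have hpj := (pd_smooth j hφ)
  have hvj := pd_smooth j hv
  have hvi := pd_smooth i hv
  have hq : ContDiff ℝ (⊤ : ℕ∞) (fun y => pd j v y - pd j φ y * v y) := hvj.sub (hpj.mul hv)
  have h1 : ContDiff ℝ (⊤ : ℕ∞) (fun y => u y * ((pd j v y - pd j φ y * v y) * Real.exp (-φ y))) :=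
    hu.mul (hq.mul hw)
  have h2 : ContDiff ℝ (⊤ : ℕ∞) (fun y => u y * (pd i v y * Real.exp (-φ y))) :=
    hu.mul (hvi.mul hw)
  have c1 : HasCompactSupport (fun y => u y * ((pd j v y - pd j φ y * v y) * Real.exp (-φ y))) :=
    hc.mul_right
  have c2 : HasCompactSupport (fun y => u y * (pd i v y * Real.exp (-φ y))) := hc.mul_right
  have i1 := (pd_smooth i h1).continuous.integrable_of_hasCompactSupport (μ := volume) (pd_hcs i c1)
  have i2 := (pd_smooth j h2).continuous.integrable_of_hasCompactSupport (μ := volume) (pd_hcs j c2)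
  have e : (fun x => ((pd i u x - pd i φ x * u x) * (pd j v x - pd j φ x * v x)
      - pd j u x * pd i v x - pd i (pd j φ) x * (u x * v x)) * Real.exp (-φ x))
      = fun x => pd i (fun y => u y * ((pd j v y - pd j φ y * v y) * Real.exp (-φ y))) x
        - pd j (fun y => u y * (pd i v y * Real.exp (-φ y))) x := by
    funext x
    rw [pd_mul i hu (hq.mul hw), pd_mul i hq hw, pd_sub i hvj (hpj.mul hv), pd_mul i hpj hv,
      pd_mul j hu (hvi.mul hw), pd_mul j hvi hw, pd_exp i hφ, pd_exp j hφ, pd_comm i j hv]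
    ring
  rw [e]
  refine ⟨i1.sub i2, ?_⟩
  rw [integral_sub i1 i2, integral_pd i h1 c1, integral_pd j h2 c2, sub_zero]

/-- vector partial derivative -/
def pv {n : ℕ} (α : (Fin n → ℝ) → SForm n) (x : Fin n → ℝ) (i : Fin n) : SForm n :=
  fderiv ℝ α x (Pi.single i 1)

/-- twisted partial derivative -/
def pw {n : ℕ} (φ : (Fin n → ℝ) → ℝ) (α : (Fin n → ℝ) → SForm n) (x : Fin n → ℝ) (i : Fin n) :
    SForm n := pv α x i - pd i φ x • α x

lemma pv_apply {n : ℕ} {α : (Fin n → ℝ) → SForm n} (hα : ContDiff ℝ (⊤ : ℕ∞) α) (x i s) :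
    pv α x i s = pd i (fun y => α y s) x := by
  unfold pv pd
  have h := (hasFDerivAt_pi'.1 ((hα.differentiable (by simp)) x).hasFDerivAt) s
  rw [h.fderiv]; rfl

lemma smooth_lin {n : ℕ} (M : Module.End ℝ (SForm n)) {α : (Fin n → ℝ) → SForm n}
    (hα : ContDiff ℝ (⊤ : ℕ∞) α) : ContDiff ℝ (⊤ : ℕ∞) (fun y => M (α y)) :=
  (LinearMap.toContinuousLinearMap M).contDiff.comp hα

lemma pv_lin {n : ℕ} (M : Module.End ℝ (SForm n)) {α : (Fin n → ℝ) → SForm n}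
    (hα : ContDiff ℝ (⊤ : ℕ∞) α) (x i) : pv (fun y => M (α y)) x i = M (pv α x i) := by
  unfold pv
  have h := ((LinearMap.toContinuousLinearMap M).hasFDerivAt).comp x
    ((hα.differentiable (by simp)) x).hasFDerivAt
  have h' : fderiv ℝ (fun y => M (α y)) x = (LinearMap.toContinuousLinearMap M).comp (fderiv ℝ α x) :=
    h.fderiv
  rw [h']; rfl

lemma pw_lin {n : ℕ} (M : Module.End ℝ (SForm n)) {α : (Fin n → ℝ) → SForm n}
    (φ : (Fin n → ℝ) → ℝ)
    (hα : ContDiff ℝ (⊤ : ℕ∞) α) (x i) : pw φ (fun y => M (α y)) x i = M (pw φ α x i) := by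
  unfold pw; rw [pv_lin M hα]; simp

lemma GG_int {n : ℕ} (M : Module.End ℝ (SForm n)) (i j : Fin n) {α : (Fin n → ℝ) → SForm n}
    {φ : (Fin n → ℝ) → ℝ} (hα : ContDiff ℝ (⊤ : ℕ∞) α) (hφ : ContDiff ℝ (⊤ : ℕ∞) φ)
    (hc : HasCompactSupport α) :
    Integrable (fun x => GG M (pw φ α x i) (pw φ α x j) (pv α x i) (pv α x j) (α x)
      (pd i (pd j φ) x) * Real.exp (-φ x)) ∧
    ∫ x, GG M (pw φ α x i) (pw φ α x j) (pv α x i) (pv α x j) (α x)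
      (pd i (pd j φ) x) * Real.exp (-φ x) = 0 := by
  have hM := smooth_lin M hα
  have hs := fun s => scalar_lemma i j (u := fun y => M (α y) s) (v := fun y => α y s)
    (contDiff_pi.1 hM s) (contDiff_pi.1 hα s) hφ
    (hc.comp_left (g := fun z => M z s) (by simp))
  have e : (fun x => GG M (pw φ α x i) (pw φ α x j) (pv α x i) (pv α x j) (α x)
      (pd i (pd j φ) x) * Real.exp (-φ x)) = fun x => ∑ s,
      ((pd i (fun y => M (α y) s) x - pd i φ x * M (α x) s)
        * (pd j (fun y => α y s) x - pd j φ x * α x s)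
      - pd j (fun y => M (α y) s) x * pd i (fun y => α y s) x
      - pd i (pd j φ) x * (M (α x) s * α x s)) * Real.exp (-φ x) := by
    funext x
    unfold GG
    rw [← pw_lin M φ hα, ← pv_lin M hα]
    simp only [sip, pw, Pi.sub_apply, Pi.smul_apply, smul_eq_mul, pv_apply hα, pv_apply hM]
    rw [Finset.mul_sum, ← Finset.sum_sub_distrib, ← Finset.sum_sub_distrib, Finset.sum_mul]
  rw [e]
  refine ⟨integrable_finsetSum _ fun s _ => (hs s).1, ?_⟩
  rw [integral_finsetSum _ fun s _ => (hs s).1]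
  exact Finset.sum_eq_zero fun s _ => (hs s).2

lemma sip_integrable {n : ℕ} {F G : (Fin n → ℝ) → SForm n} {φ : (Fin n → ℝ) → ℝ}
    (hF : Continuous F) (hG : Continuous G) (hφ : Continuous φ) (K : Set (Fin n → ℝ))
    (hK : IsCompact K) (h0 : ∀ x, x ∉ K → G x = 0) :
    Integrable (fun x => sip (F x) (G x) * Real.exp (-φ x)) := by
  refine Continuous.integrable_of_hasCompactSupport ?_ ?_
  · unfold sip; fun_prop
  · refine HasCompactSupport.intro hK fun x hx => ?_
    rw [h0 x hx]; simp [sip]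

lemma dS_eq {n : ℕ} (α : (Fin n → ℝ) → SForm n) (x) :
    dS n α x = ∑ i, crE (dxI n i) (pv α x i) := by
  simp only [dS, wedge_sDx, pv]

lemma dShPhi_eq {n : ℕ} (φ : (Fin n → ℝ) → ℝ) (α : (Fin n → ℝ) → SForm n) (x) :
    dShPhi n φ α x = ∑ i, crE (dxiI n i) (pw φ α x i) := by
  simp only [dShPhi, dSh, dShFun, wedge_sum_left, wedge_smul_left, wedge_sDxi, pw, pv, pd, map_sub,
    map_smul, Finset.sum_sub_distrib]

lemma wedge_dd_eq {n : ℕ} (φ : (Fin n → ℝ) → ℝ) (y : SForm n) (x) :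
    wedge (ddShFun n φ x) y
      = ∑ i, ∑ j, pd i (pd j φ) x • crE (dxI n i) (crE (dxiI n j) y) := by
  simp only [ddShFun, wedge_sum_left, wedge_smul_left, wedge_two]; rfl

lemma comm_d {n : ℕ} (Lam : Module.End ℝ (SForm n))
    (hLam : Lam = ∑ i : Fin n, anA (dxiI n i) * anA (dxI n i))
    {α : (Fin n → ℝ) → SForm n} (hα : ContDiff ℝ (⊤ : ℕ∞) α) (x) :
    Lam (dS n α x) - dS n (fun y => Lam (α y)) x = ∑ i, anA (dxiI n i) (pv α x i) := by
  rw [dS_eq, dS_eq, map_sum, ← Finset.sum_sub_distrib]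
  refine Finset.sum_congr rfl fun i _ => ?_
  rw [pv_lin Lam hα]
  exact LinearMap.congr_fun (Lam_comm_E Lam hLam i) (pv α x i)

lemma comm_dsh {n : ℕ} (Lam : Module.End ℝ (SForm n))
    (hLam : Lam = ∑ i : Fin n, anA (dxiI n i) * anA (dxI n i))
    (φ : (Fin n → ℝ) → ℝ)
    {α : (Fin n → ℝ) → SForm n} (hα : ContDiff ℝ (⊤ : ℕ∞) α) (x) :
    Lam (dShPhi n φ α x) - dShPhi n φ (fun y => Lam (α y)) x
      = - ∑ i, anA (dxI n i) (pw φ α x i) := by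
  rw [dShPhi_eq, dShPhi_eq, map_sum, ← Finset.sum_sub_distrib, ← Finset.sum_neg_distrib]
  refine Finset.sum_congr rfl fun i _ => ?_
  rw [pw_lin Lam φ hα]
  exact LinearMap.congr_fun (Lam_comm_F Lam hLam i) (pw φ α x i)

lemma cont_lin {n : ℕ} (M : Module.End ℝ (SForm n)) {F : (Fin n → ℝ) → SForm n}
    (hF : Continuous F) : Continuous fun x => M (F x) :=
  (LinearMap.continuous_of_finiteDimensional M).comp hF

lemma cont_pv {n : ℕ} {α : (Fin n → ℝ) → SForm n} (hα : ContDiff ℝ (⊤ : ℕ∞) α) (i) :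
    Continuous fun x => pv α x i :=
  (hα.continuous_fderiv (by simp)).clm_apply continuous_const

lemma cont_pw {n : ℕ} {φ : (Fin n → ℝ) → ℝ} {α : (Fin n → ℝ) → SForm n}
    (hφ : ContDiff ℝ (⊤ : ℕ∞) φ) (hα : ContDiff ℝ (⊤ : ℕ∞) α) (i) :
    Continuous fun x => pw φ α x i :=
  (cont_pv hα i).sub ((pd_smooth i hφ).continuous.smul hα.continuous)

lemma five_int {X : Type*} [MeasurableSpace X] {μ : Measure X} {A B C D F : X → ℝ}
    (hA : Integrable A μ) (hB : Integrable B μ) (hC : Integrable C μ) (hD : Integrable D μ)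
    (hF : Integrable F μ) (h : ∫ x, (A x + B x - C x - D x - F x) ∂μ = 0) :
    ((∫ x, A x ∂μ) + ∫ x, B x ∂μ) = (∫ x, C x ∂μ) + (∫ x, D x ∂μ) + ∫ x, F x ∂μ := by
  have h1 : Integrable (fun x => A x + B x) μ := hA.add hB
  have h2 : Integrable (fun x => A x + B x - C x) μ := h1.sub hC
  have h3 : Integrable (fun x => A x + B x - C x - D x) μ := h2.sub hD
  rw [integral_sub h3 hF, integral_sub h2 hD, integral_sub h1 hC, integral_add hA hB] at h
  linarith

/-- integrated Bochner–Kodaira–Nakano identity: for smooth `φ` and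
every smooth compactly supported super form `α` on `ℝⁿ`,
`‖[Λ,d#_φ]α‖²_φ + ‖dα‖²_φ = ‖[Λ,d]α‖²_φ + ‖d#_φα‖²_φ + ∫ ⟨[dd#φ,Λ]α, α⟩ e^{−φ}`,
where `‖γ‖²_φ = ∫ |γ(x)|² e^{−φ(x)} dx`. -/
theorem integrated_bochner_kodaira_nakano (n : ℕ) (hn : 1 ≤ n)
    (Lam : SForm n →ₗ[ℝ] SForm n)
    (hLam : ∀ x y : SForm n, sip (Lop n x) y = sip x (Lam y))
    (φ : (Fin n → ℝ) → ℝ) (hφ : ContDiff ℝ (⊤ : ℕ∞) φ)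
    (α : (Fin n → ℝ) → SForm n) (hα : ContDiff ℝ (⊤ : ℕ∞) α) (hαc : HasCompactSupport α) :
    (∫ x : Fin n → ℝ,
        sip (Lam (dShPhi n φ α x) - dShPhi n φ (fun y => Lam (α y)) x)
            (Lam (dShPhi n φ α x) - dShPhi n φ (fun y => Lam (α y)) x)
          * Real.exp (-φ x))
      + (∫ x : Fin n → ℝ, sip (dS n α x) (dS n α x) * Real.exp (-φ x))
    = (∫ x : Fin n → ℝ,
        sip (Lam (dS n α x) - dS n (fun y => Lam (α y)) x)
            (Lam (dS n α x) - dS n (fun y => Lam (α y)) x)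
          * Real.exp (-φ x))
      + (∫ x : Fin n → ℝ, sip (dShPhi n φ α x) (dShPhi n φ α x) * Real.exp (-φ x))
      + ∫ x : Fin n → ℝ,
          sip (wedge (ddShFun n φ x) (Lam (α x)) - Lam (wedge (ddShFun n φ x) (α x))) (α x)
            * Real.exp (-φ x) := by
  have hL := Lam_eq Lam hLam
  have hz : ∀ x, x ∉ tsupport α → α x = 0 := fun x hx => image_eq_zero_of_notMem_tsupport hx
  have hv : ∀ x, x ∉ tsupport α → ∀ i, pv α x i = 0 := by
    intro x hx i
    have : fderiv ℝ α x = 0 :=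
      Function.notMem_support.1 fun h => hx (support_fderiv_subset ℝ h)
    simp [pv, this]
  have hw : ∀ x, x ∉ tsupport α → ∀ i, pw φ α x i = 0 := by
    intro x hx i; simp [pw, hv x hx, hz x hx]
  simp only [comm_d Lam hL hα, comm_dsh Lam hL φ hα]
  simp only [sip_neg_neg, dS_eq, dShPhi_eq, wedge_dd_eq]
  have cSum : ∀ (M : Fin n → Module.End ℝ (SForm n)) (c : (Fin n → ℝ) → Fin n → SForm n),
      (∀ i, Continuous fun x => c x i) → Continuous fun x => ∑ i, M i (c x i) :=
    fun M c hc => continuous_finsetSum _ fun i _ => cont_lin (M i) (hc i)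
  have I : ∀ (M : Fin n → Module.End ℝ (SForm n)) (c : (Fin n → ℝ) → Fin n → SForm n),
      (∀ i, Continuous fun x => c x i) → (∀ x, x ∉ tsupport α → ∀ i, c x i = 0) →
      Integrable (fun x => sip (∑ i, M i (c x i)) (∑ i, M i (c x i)) * Real.exp (-φ x)) := by
    intro M c hc h0
    refine sip_integrable (cSum M c hc) (cSum M c hc) hφ.continuous (tsupport α) hαc ?_
    intro x hx; simp [h0 x hx]
  have I1 := I (fun i => anA (dxI n i)) (fun x => pw φ α x) (cont_pw hφ hα) hw
  have I2 := I (fun i => crE (dxI n i)) (fun x => pv α x) (cont_pv hα) hv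
  have I3 := I (fun i => anA (dxiI n i)) (fun x => pv α x) (cont_pv hα) hv
  have I4 := I (fun i => crE (dxiI n i)) (fun x => pw φ α x) (cont_pw hφ hα) hw
  have c0 : ∀ M : Module.End ℝ (SForm n), Continuous fun x => ∑ i, ∑ j,
      pd i (pd j φ) x • crE (dxI n i) (crE (dxiI n j) (M (α x))) := by
    intro M
    refine continuous_finsetSum _ fun i _ => continuous_finsetSum _ fun j _ => ?_
    exact (pd_smooth i (pd_smooth j hφ)).continuous.smul
      (cont_lin _ (cont_lin _ (cont_lin _ hα.continuous)))
  have I5 := sip_integrable (φ := φ) ((c0 Lam).sub (cont_lin Lam (c0 1))) hα.continuous hφ.continuous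
    (tsupport α) hαc hz
  simp only [Module.End.one_apply, Pi.sub_apply] at I5
  refine five_int I1 I2 I3 I4 I5 ?_
  have hG := fun (M : Module.End ℝ (SForm n)) (i j : Fin n) => GG_int M i j hα hφ hαc
  have J : ∀ i j, Integrable (fun x =>
      (GG (crE (dxI n j) * anA (dxI n i)) (pw φ α x i) (pw φ α x j) (pv α x i) (pv α x j) (α x)
        (pd i (pd j φ) x) * Real.exp (-φ x)
      + GG (crE (dxiI n i) * anA (dxiI n j)) (pw φ α x i) (pw φ α x j) (pv α x i) (pv α x j) (α x)
        (pd i (pd j φ) x) * Real.exp (-φ x)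
      - if i = j then GG 1 (pw φ α x i) (pw φ α x j) (pv α x i) (pv α x j) (α x)
        (pd i (pd j φ) x) * Real.exp (-φ x) else 0)) ∧ ∫ x,
      (GG (crE (dxI n j) * anA (dxI n i)) (pw φ α x i) (pw φ α x j) (pv α x i) (pv α x j) (α x)
        (pd i (pd j φ) x) * Real.exp (-φ x)
      + GG (crE (dxiI n i) * anA (dxiI n j)) (pw φ α x i) (pw φ α x j) (pv α x i) (pv α x j) (α x)
        (pd i (pd j φ) x) * Real.exp (-φ x)
      - if i = j then GG 1 (pw φ α x i) (pw φ α x j) (pv α x i) (pv α x j) (α x)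
        (pd i (pd j φ) x) * Real.exp (-φ x) else 0) = 0 := by
    intro i j
    have A := hG (crE (dxI n j) * anA (dxI n i)) i j
    have B := hG (crE (dxiI n i) * anA (dxiI n j)) i j
    have C := hG 1 i j
    split_ifs
    · refine ⟨(A.1.add B.1).sub C.1, ?_⟩
      refine (integral_sub (A.1.add B.1) C.1).trans ?_
      rw [C.2, sub_zero]
      refine (integral_add A.1 B.1).trans ?_
      rw [A.2, B.2, add_zero]
    · simp only [sub_zero]
      refine ⟨A.1.add B.1, ?_⟩
      rw [integral_add A.1 B.1, A.2, B.2]; simp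
  calc _ = ∫ x, ∑ i, ∑ j, (GG (crE (dxI n j) * anA (dxI n i)) (pw φ α x i) (pw φ α x j) (pv α x i)
        (pv α x j) (α x) (pd i (pd j φ) x) * Real.exp (-φ x)
      + GG (crE (dxiI n i) * anA (dxiI n j)) (pw φ α x i) (pw φ α x j) (pv α x i) (pv α x j) (α x)
        (pd i (pd j φ) x) * Real.exp (-φ x)
      - if i = j then GG 1 (pw φ α x i) (pw φ α x j) (pv α x i) (pv α x j) (α x)
        (pd i (pd j φ) x) * Real.exp (-φ x) else 0) := by
        refine integral_congr_ae (Filter.Eventually.of_forall fun x => ?_)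
        have P := pointwise_alg Lam hL (pv α x) (pw φ α x) (α x) (fun i j => pd i (pd j φ) x)
        have P' := congrArg (fun t => t * Real.exp (-φ x)) P
        simp only [Finset.sum_mul, sub_mul, add_mul, ite_mul, zero_mul] at P'
        exact P'
    _ = 0 := by
        rw [integral_finsetSum _ fun i _ => integrable_finsetSum _ fun j _ => (J i j).1]
        refine Finset.sum_eq_zero fun i _ => ?_
        rw [integral_finsetSum _ fun j _ => (J i j).1]
        exact Finset.sum_eq_zero fun j _ => (J i j).2
end
end
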